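/- Let G ≠ 1 be a finite nilpotent group, K := ℚ(G), and ℤ_K the ring of integers of K. Then the exponent of the finite abelian group ℤ_K/ℤ[G] is a proper divisor of |G|; in particular |G|·ℤ_K ⊆ ℤ[G]. -/

import Mathlib

open CategoryTheory Module Pointwise
open scoped MatrixGroups

/-- The set of all values `χ(g)` of irreducible complex characters `χ` of `G`. -/
noncomputable def charValues (G : Type) [Group G] : Set ℂ :=
  {z : ℂ | ∃ V : FDRep ℂ G, Simple V ∧ ∃ g : G, V.character g = z}

/-- `ℚ(G)`, the field of character values of `G`, as a subfield of `ℂ`. -/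
noncomputable def charField (G : Type) [Group G] : Subfield ℂ :=
  Subfield.closure (charValues G)

/-- `ℤ[G]`, the subring of `ℂ` generated by the character values of `G`. -/
noncomputable def charRing (G : Type) [Group G] : Subring ℂ :=
  Subring.closure (charValues G)

/-- The ring of integers of a subfield `K` of `ℂ`, i.e. the elements of `K` integral
over `ℤ`, as a subring of `ℂ`. -/
noncomputable def ringOfIntIn (K : Subfield ℂ) : Subring ℂ :=
  (integralClosure ℤ ℂ).toSubring ⊓ K.toSubring

/-- The additive quotient group `ℤ_{ℚ(G)}/ℤ[G]`. -/
noncomputable def charQuot (G : Type) [Group G] :=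
  ↥((ringOfIntIn (charField G)).toAddSubgroup) ⧸
    ((charRing G).toAddSubgroup.addSubgroupOf (ringOfIntIn (charField G)).toAddSubgroup)

noncomputable instance (G : Type) [Group G] : AddCommGroup (charQuot G) := by
  unfold charQuot; infer_instance

/-- The `m`-th cyclotomic field `ℚ(ζ_m)`, as the subfield of `ℂ` generated by the
`m`-th roots of unity. -/
noncomputable def cycField (m : ℕ) : Subfield ℂ :=
  Subfield.closure {z : ℂ | z ^ m = 1}

/-- The set of values `χ(g)` at a fixed `g` of irreducible complex characters `χ` of `G`. -/
noncomputable def charValuesAt {G : Type} [Group G] (g : G) : Set ℂ :=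
  {z : ℂ | ∃ V : FDRep ℂ G, Simple V ∧ V.character g = z}

/-- `ℚ(g)`, the subfield of `ℂ` generated by one column of the character table. -/
noncomputable def charFieldAt {G : Type} [Group G] (g : G) : Subfield ℂ :=
  Subfield.closure (charValuesAt g)

/-- `ℤ[g]`, the subring of `ℂ` generated by one column of the character table. -/
noncomputable def charRingAt {G : Type} [Group G] (g : G) : Subring ℂ :=
  Subring.closure (charValuesAt g)

/-- The group `P` contains a central element `z` of order `p`
and an element `e` of exponent `p` outside `⟨z⟩` all of whose conjugates lie in `e⟨z⟩`. -/
def HasTwist (p : ℕ) (P : Type) [Group P] : Prop :=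
  ∃ z e : P, z ∈ Subgroup.center P ∧ z ≠ 1 ∧ z ^ p = 1 ∧ e ^ p = 1 ∧
    e ∉ Subgroup.zpowers z ∧ ∀ g, g * e * g⁻¹ * e⁻¹ ∈ Subgroup.zpowers z

section GroupTheory

variable {P : Type} [Group P]

theorem conj_pow_of_conj {g a : P} {k : ℕ} (h : g * a * g⁻¹ = a ^ k) (M : ℕ) :
    g ^ M * a * (g ^ M)⁻¹ = a ^ k ^ M := by
  induction M with
  | zero => simp
  | succ M ih =>
    calc g ^ (M + 1) * a * (g ^ (M + 1))⁻¹ = g * (g ^ M * a * (g ^ M)⁻¹) * g⁻¹ := by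
          rw [pow_succ']; group
      _ = (g * a * g⁻¹) ^ k ^ M := by rw [ih, conj_pow]
      _ = a ^ k ^ (M + 1) := by rw [h, ← pow_mul, pow_succ']

theorem mul_pow_of_conj {x a : P} {r : ℕ} (h : x * a * x⁻¹ = a ^ r) (i l : ℕ) :
    (a ^ i * x) ^ l = a ^ (i * ∑ t ∈ Finset.range l, r ^ t) * x ^ l := by
  induction l with
  | zero => simp
  | succ l ih =>
    have hx : ∀ m : ℕ, x * a ^ m = a ^ (r * m) * x := fun m ↦ by
      rw [pow_mul, ← h, conj_pow]; group
    rw [pow_succ', ih, geom_sum_succ, mul_assoc, ← mul_assoc x, hx, pow_succ', mul_add, pow_add,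
      mul_one, ← mul_left_comm r, mul_assoc, mul_assoc]
    simp only [← mul_assoc, ← pow_add, add_comm]

theorem exists_conj_eq_pow [Finite P] {a : P} (hA : (Subgroup.zpowers a).Normal) (g : P) :
    ∃ k : ℕ, g * a * g⁻¹ = a ^ k := by
  have := hA.conj_mem a (Subgroup.mem_zpowers a) g
  rw [← mem_powers_iff_mem_zpowers] at this
  obtain ⟨k, hk⟩ := this
  exact ⟨k, hk.symm⟩

theorem conj_exponent_modEq_one {p : ℕ} [hp : Fact p.Prime] (hP : IsPGroup p P) {n : ℕ}
    (hn : n ≠ 0) {g a : P} (ha : orderOf a = p ^ n) {k : ℕ} (h : g * a * g⁻¹ = a ^ k) :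
    k ≡ 1 [MOD p] := by
  obtain ⟨N, hN⟩ := hP g
  have h1 := conj_pow_of_conj h (p ^ N)
  rw [hN] at h1
  simp only [one_mul, inv_one, mul_one] at h1
  have h2 : 1 ≡ k ^ p ^ N [MOD p ^ n] := by
    rw [← ha, ← pow_eq_pow_iff_modEq, pow_one]; exact h1
  have h3 := h2.of_dvd (dvd_pow_self p hn)
  rw [← ZMod.natCast_eq_natCast_iff] at h3 ⊢
  push_cast at h3
  rw [ZMod.pow_card_pow] at h3
  exact_mod_cast h3.symm

theorem pow_mem_center_of_zpowers_normal {p : ℕ} [hp : Fact p.Prime] [Finite P]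
    (hP : IsPGroup p P) {n : ℕ} {a : P} (ha : orderOf a = p ^ (n + 1))
    (hA : (Subgroup.zpowers a).Normal) : a ^ p ^ n ∈ Subgroup.center P := by
  rw [Subgroup.mem_center_iff]
  intro g
  obtain ⟨k, hk⟩ := exists_conj_eq_pow hA g
  have h1 := conj_exponent_modEq_one hP n.succ_ne_zero ha hk
  have h2 : g * a ^ p ^ n * g⁻¹ = a ^ p ^ n := by
    rw [← conj_pow, hk, ← pow_mul, pow_eq_pow_iff_modEq, ha, pow_succ']
    simpa using h1.mul_right' (p ^ n)
  exact mul_inv_eq_iff_eq_mul.mp h2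

theorem hasTwist_of_zpowers_normal {p : ℕ} [hp : Fact p.Prime] [Finite P]
    (hP : IsPGroup p P) {n : ℕ} {a x : P} (ha : orderOf a = p ^ (n + 1))
    (hA : (Subgroup.zpowers a).Normal) (hx : x ∉ Subgroup.zpowers a) {r s u : ℕ}
    (hr : x * a * x⁻¹ = a ^ r) (hs : x ^ p = a ^ (p * s))
    (hu : ∑ t ∈ Finset.range p, r ^ t = p * u) (hpu : p.Coprime u)
    (hconj : ∀ g, g * x * g⁻¹ * x⁻¹ ∈ Subgroup.zpowers a) : HasTwist p P := by
  have hz := pow_mem_center_of_zpowers_normal hP ha hA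
  obtain ⟨i, hi⟩ : ∃ i : ℕ, p ^ (n + 1) ∣ i * u + s := by
    have : Invertible (u : ZMod (p ^ (n + 1))) :=
      (((ZMod.isUnit_iff_coprime u _).2 (hpu.pow_left (n + 1)).symm)).invertible
    have : NeZero (p ^ (n + 1)) := ⟨pow_ne_zero _ hp.out.ne_zero⟩
    refine ⟨(-s * ⅟(u : ZMod (p ^ (n + 1))) : ZMod (p ^ (n + 1))).val, ?_⟩
    rw [← ZMod.natCast_eq_zero_iff]
    push_cast
    rw [ZMod.natCast_zmod_val, mul_assoc, invOf_mul_self]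
    ring
  have hconj_e : a ^ i * x * a * (a ^ i * x)⁻¹ = a ^ r := by
    rw [mul_inv_rev]
    calc a ^ i * x * a * (x⁻¹ * (a ^ i)⁻¹) = a ^ i * (x * a * x⁻¹) * (a ^ i)⁻¹ := by group
      _ = a ^ r := by rw [hr]; group
  have he : (a ^ i * x) ^ p = 1 := by
    rw [mul_pow_of_conj hr, hu, hs, ← pow_add, ← orderOf_dvd_iff_pow_eq_one, ha]
    exact hi.trans ⟨p, by ring⟩
  have hxe : a ^ i * x ∉ Subgroup.zpowers a := fun h ↦ hx <| by
    rwa [Subgroup.mul_mem_cancel_left _ (Subgroup.npow_mem_zpowers a i)] at h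
  refine ⟨a ^ p ^ n, a ^ i * x, hz, fun h ↦ ?_, ?_, he, fun h ↦ ?_, fun g ↦ ?_⟩
  · rw [← orderOf_dvd_iff_pow_eq_one, ha] at h
    exact absurd (Nat.le_of_dvd (pow_pos hp.out.pos _) h)
      (not_le.2 (Nat.pow_lt_pow_right hp.out.one_lt n.lt_succ_self))
  · rw [← pow_mul, ← pow_succ, ← ha, pow_orderOf_eq_one]
  · exact hxe (Subgroup.zpowers_le_of_mem (Subgroup.npow_mem_zpowers a _) h)
  · have h1 : g * (a ^ i * x) * g⁻¹ * (a ^ i * x)⁻¹ ∈ Subgroup.zpowers a := by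
      have e1 : g * (a ^ i * x) * g⁻¹ * (a ^ i * x)⁻¹ =
          (g * a ^ i * g⁻¹) * (g * x * g⁻¹ * x⁻¹) * (a ^ i)⁻¹ := by group
      rw [e1]
      exact mul_mem (mul_mem (hA.conj_mem _ (Subgroup.npow_mem_zpowers a i) g) (hconj g))
        (inv_mem (Subgroup.npow_mem_zpowers a i))
    rw [← mem_powers_iff_mem_zpowers] at h1
    obtain ⟨t, ht⟩ := h1
    simp only at ht
    have h2 : g * (a ^ i * x) * g⁻¹ = a ^ t * (a ^ i * x) := by
      rw [ht]; group
    have h3 : (a ^ t * (a ^ i * x)) ^ p = 1 := by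
      rw [← h2, conj_pow, he]; group
    rw [mul_pow_of_conj hconj_e, he, mul_one, hu, ← orderOf_dvd_iff_pow_eq_one, ha,
      pow_succ', mul_left_comm, Nat.mul_dvd_mul_iff_left hp.out.pos] at h3
    obtain ⟨w, rfl⟩ := (hpu.pow_left n).dvd_of_dvd_mul_right h3
    rw [← ht, pow_mul]
    exact Subgroup.npow_mem_zpowers _ _

end GroupTheory

theorem exists_geom_sum_eq_mul {p : ℕ} [hp : Fact p.Prime] {d : ℕ} (hd : p ∣ d)
    (hd2 : p = 2 → 4 ∣ d) : ∃ u, ∑ t ∈ Finset.range p, (1 + d) ^ t = p * u ∧ p.Coprime u := by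
  suffices h : ∃ w, ∑ t ∈ Finset.range p, (1 + d) ^ t = p * (1 + p * w) by
    obtain ⟨w, hw⟩ := h
    exact ⟨_, hw, by simp⟩
  rcases hp.out.eq_two_or_odd' with rfl | hodd
  · obtain ⟨c, rfl⟩ := hd2 rfl
    exact ⟨c, by simp [Finset.sum_range_succ]; ring⟩
  have hq : ∀ t, ∃ q, (1 + d) ^ t = 1 + t * d + d ^ 2 * q := fun t ↦ by
    induction t with
    | zero => exact ⟨0, by simp⟩
    | succ t ih =>
      obtain ⟨q, hq⟩ := ih
      exact ⟨t + q + d * q, by rw [pow_succ, hq]; ring⟩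
  choose q hq using hq
  obtain ⟨c, rfl⟩ := hd
  obtain ⟨m, hm⟩ := hodd
  have hs : ∑ t ∈ Finset.range p, t = p * m := by
    have := Finset.sum_range_id_mul_two p
    have h2 : p - 1 = 2 * m := by omega
    rw [h2] at this
    nlinarith
  refine ⟨c * m + c ^ 2 * ∑ t ∈ Finset.range p, q t, ?_⟩
  rw [Finset.sum_congr rfl fun t _ ↦ hq t]
  simp only [Finset.sum_add_distrib, ← Finset.sum_mul, ← Finset.mul_sum, hs]
  simp
  ring

theorem exists_pow_modEq_one_add {p : ℕ} [hp : Fact p.Prime] {n d : ℕ} (hd : p ∣ d)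
    (hd2 : p = 2 → 4 ∣ d) (hn : ¬ p ^ n ∣ d) :
    ∃ M, (1 + d) ^ M ≡ 1 + p ^ (n - 1) [MOD p ^ n] := by
  suffices h : ∀ j d, p ∣ d → (p = 2 → 4 ∣ d) → ¬ p ^ n ∣ d → p ^ (n - 1 - j) ∣ d →
      ∃ M, (1 + d) ^ M ≡ 1 + p ^ (n - 1) [MOD p ^ n] from
    h (n - 1) d hd hd2 hn (by simp)
  clear! d
  intro j
  induction j with
  | zero =>
    rintro d hd hd2 hn ⟨c, rfl⟩
    have hn2 : 2 ≤ n := by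
      by_contra! h
      have : p ^ n ∣ p ^ 1 := pow_dvd_pow _ (by omega)
      rw [pow_one] at this
      exact hn (this.trans hd)
    have hc : c.Coprime p := by
      refine ((Nat.Prime.coprime_iff_not_dvd hp.out).2 fun h ↦ hn ?_).symm
      obtain ⟨m, rfl⟩ := h
      obtain ⟨n, rfl⟩ : ∃ m, n = m + 1 := ⟨n - 1, by omega⟩
      exact ⟨m, by simp [pow_succ]; ring⟩
    obtain ⟨M, hM⟩ := Nat.exists_mul_mod_eq_one_of_coprime hc hp.out.one_lt
    refine ⟨M, ?_⟩
    have hq : ∀ t, ∃ q, (1 + p ^ (n - 1) * c) ^ t = 1 + p ^ (n - 1) * c * t + p ^ n * q :=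
        fun t ↦ by
      induction t with
      | zero => exact ⟨0, by simp⟩
      | succ t ih =>
        obtain ⟨q, hq⟩ := ih
        refine ⟨p ^ (n - 2) * c ^ 2 * t + q + p ^ (n - 1) * c * q, ?_⟩
        have e : p ^ (n - 1) * p ^ (n - 1) = p ^ n * p ^ (n - 2) := by
          rw [← pow_add, ← pow_add]; congr 1; omega
        rw [pow_succ, hq]
        linear_combination (c ^ 2 * t) * e
    obtain ⟨q, hq⟩ := hq M
    have e : c * M = p * (c * M / p) + 1 := by
      conv_lhs => rw [← Nat.div_add_mod (c * M) p, hM.2]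
    have e' : p ^ n = p ^ (n - 1) * p := by
      rw [← pow_succ]; congr 1; omega
    have : 1 + p ^ (n - 1) * c * M + p ^ n * q =
        1 + p ^ (n - 1) + p ^ n * (c * M / p + q) := by
      rw [mul_assoc, e, e', Nat.mul_add_div hp.out.pos, Nat.div_eq_of_lt hp.out.one_lt]
      ring
    rw [Nat.sub_zero, hq, this]
    simp [Nat.ModEq]
  | succ j ih =>
    intro d hd hd2 hn hj
    by_cases h : p ^ (n - 1 - j) ∣ d
    · exact ih d hd hd2 hn h
    obtain ⟨u, hu, hpu⟩ := exists_geom_sum_eq_mul hd hd2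
    have hd' : (1 + d) ^ p = 1 + d * (p * u) := by
      have := Commute.geom_sum₂_mul_add (Commute.all d 1) p
      simp only [one_pow, mul_one] at this
      rw [← hu, add_comm 1 d, ← this]
      ring
    obtain ⟨M, hM⟩ : ∃ M, (1 + d * (p * u)) ^ M ≡ 1 + p ^ (n - 1) [MOD p ^ n] := by
      refine ih (d * (p * u)) (hd.mul_right _) (fun h ↦ (hd2 h).mul_right _) (fun h' ↦ ?_) ?_
      · rcases n with _ | n
        · exact h (by simp)
        rw [pow_succ', mul_left_comm, Nat.mul_dvd_mul_iff_left hp.out.pos] at h'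
        exact h ((pow_dvd_pow p (by omega)).trans ((hpu.pow_left n).dvd_of_dvd_mul_right h'))
      · by_cases h0 : n - 1 - j = 0
        · simp [h0]
        · rw [show n - 1 - j = n - 1 - (j + 1) + 1 by omega, pow_succ]
          exact mul_dvd_mul hj (dvd_mul_right _ _)
    exact ⟨p * M, by rwa [pow_mul, hd']⟩

theorem IsPGroup.exists_mem_center_of_normal {p : ℕ} [hp : Fact p.Prime] {Q : Type} [Group Q]
    [Finite Q] (hQ : IsPGroup p Q) (N : Subgroup Q) [N.Normal] (hN : N ≠ ⊥) :
    ∃ c ∈ N, c ∈ Subgroup.center Q ∧ c ≠ 1 ∧ c ^ p = 1 := by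
  have h1 : p ∣ Nat.card N := by
    have : Nontrivial N := (Subgroup.nontrivial_iff_ne_bot N).2 hN
    obtain ⟨n, hn0, hn⟩ := (hQ.to_subgroup N).nontrivial_iff_card.mp inferInstance
    exact hn.symm ▸ dvd_pow_self _ hn0.ne'
  obtain ⟨b, hb, hb1⟩ := (hQ.of_equiv ConjAct.toConjAct).exists_fixed_point_of_prime_dvd_card_of_fixed_point
    N h1 (a := 1) (fun g ↦ smul_one g)
  have hbc : (b : Q) ∈ Subgroup.center Q := by
    rw [Subgroup.mem_center_iff]
    intro g
    have := congrArg Subtype.val (hb (ConjAct.toConjAct g))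
    rw [ConjAct.Subgroup.val_conj_smul, ConjAct.toConjAct_smul] at this
    exact mul_inv_eq_iff_eq_mul.mp this
  obtain ⟨k, hk⟩ := (IsPGroup.iff_orderOf.1 hQ) (b : Q)
  have hk0 : k ≠ 0 := by
    rintro rfl
    rw [pow_zero, orderOf_eq_one_iff] at hk
    exact hb1 (Subtype.ext hk.symm)
  obtain ⟨k, rfl⟩ := Nat.exists_eq_succ_of_ne_zero hk0
  refine ⟨(b : Q) ^ p ^ k, pow_mem b.2 _, pow_mem hbc _, fun h ↦ ?_, ?_⟩
  · rw [← orderOf_dvd_iff_pow_eq_one, hk] at h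
    exact absurd (Nat.le_of_dvd (pow_pos hp.out.pos _) h)
      (not_le.2 (Nat.pow_lt_pow_right hp.out.one_lt k.lt_succ_self))
  · rw [← pow_mul, ← pow_succ, ← Nat.succ_eq_add_one, ← hk, pow_orderOf_eq_one]

section GroupTheory

variable {P : Type} [Group P]

theorem mem_zpowers_of_commute {p : ℕ} [hp : Fact p.Prime] [Finite P] (hP : IsPGroup p P)
    (hT : ¬ HasTwist p P) {n : ℕ} {a : P} (ha : orderOf a = p ^ (n + 1))
    (hA : (Subgroup.zpowers a).Normal)
    (hmax : ∀ b : P, (Subgroup.zpowers b).Normal → orderOf b ≤ orderOf a) {y : P}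
    (hy : y * a = a * y) : y ∈ Subgroup.zpowers a := by
  by_contra hyA
  let f := QuotientGroup.mk' (Subgroup.zpowers a)
  let C := Subgroup.centralizer (Subgroup.zpowers a : Set P)
  have hyC : y ∈ C := by
    rw [Subgroup.mem_centralizer_iff]
    rintro h ⟨i, rfl⟩
    exact (Commute.zpow_right (show Commute y a from hy) i).symm
  have hN : (C.map f).Normal := Subgroup.Normal.map inferInstance f (QuotientGroup.mk'_surjective _)
  have hNe : C.map f ≠ ⊥ := fun h ↦ hyA <| by
    have : f y ∈ C.map f := Subgroup.mem_map_of_mem f hyC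
    rw [h, Subgroup.mem_bot] at this
    exact (QuotientGroup.eq_one_iff y).1 this
  obtain ⟨_, ⟨x, hxC, rfl⟩, hc, hc1, hcp⟩ :=
    (hP.to_quotient (Subgroup.zpowers a)).exists_mem_center_of_normal (C.map f) hNe
  have hxA : x ∉ Subgroup.zpowers a := fun h ↦ hc1 ((QuotientGroup.eq_one_iff x).2 h)
  have hxp : x ^ p ∈ Subgroup.zpowers a := by
    rw [← map_pow] at hcp
    exact (QuotientGroup.eq_one_iff _).1 hcp
  have hconj : ∀ g, g * x * g⁻¹ * x⁻¹ ∈ Subgroup.zpowers a := fun g ↦ by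
    rw [← QuotientGroup.eq_one_iff]
    have := (Subgroup.mem_center_iff.1 hc) (f g)
    change f (g * x * g⁻¹ * x⁻¹) = 1
    simp only [map_mul, map_inv, this]
    group
  have hxa : x * a = a * x :=
    ((Subgroup.mem_centralizer_iff.1 hxC) a (Subgroup.mem_zpowers a)).symm
  obtain ⟨s, hs⟩ := (mem_powers_iff_mem_zpowers.2 hxp)
  simp only at hs
  by_cases hps : p ∣ s
  · obtain ⟨s, rfl⟩ := hps
    exact hT (hasTwist_of_zpowers_normal hP ha hA hxA (r := 1) (s := s) (u := 1)
      (by rw [hxa]; group) hs.symm (by simp) (by simp) hconj)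
  · have hax : a ∈ Subgroup.zpowers x := by
      have h1 : (orderOf a).Coprime s := by
        rw [ha]
        exact ((Nat.Prime.coprime_iff_not_dvd hp.out).2 hps).pow_left _
      have h2 : a ^ s ∈ Subgroup.zpowers x := hs ▸ Subgroup.npow_mem_zpowers x p
      obtain ⟨t, ht⟩ := exists_pow_eq_self_of_coprime h1.symm
      rw [← ht]
      exact pow_mem h2 t
    have hle := Subgroup.zpowers_le_of_mem hax
    have hxN : (Subgroup.zpowers x).Normal := by
      refine ⟨fun b ⟨i, hi⟩ g ↦ ?_⟩
      rw [← hi]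
      simp only
      rw [← conj_zpow]
      refine zpow_mem ?_ i
      have := mul_mem (hle (hconj g)) (Subgroup.mem_zpowers x)
      simpa using this
    have h3 := hmax x hxN
    rw [← Nat.card_zpowers, ← Nat.card_zpowers] at h3
    exact hxA (Subgroup.eq_of_le_of_card_ge hle h3 ▸ Subgroup.mem_zpowers x)

theorem dvd_of_not_hasTwist {p : ℕ} [hp : Fact p.Prime] [Finite P] (hP : IsPGroup p P)
    (hT : ¬ HasTwist p P) {n : ℕ} {a : P} (ha : orderOf a = p ^ (n + 1))
    (hA : (Subgroup.zpowers a).Normal)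
    (hC : ∀ y : P, y * a = a * y → y ∈ Subgroup.zpowers a) {g : P} {d : ℕ}
    (hg : g * a * g⁻¹ = a ^ (1 + d)) (hd : p ∣ d) (hd2 : p = 2 → 4 ∣ d) : p ^ (n + 1) ∣ d := by
  by_contra hnd
  obtain ⟨M, hM⟩ := exists_pow_modEq_one_add hd hd2 hnd
  have hgM := conj_pow_of_conj hg M
  have hM' : a ^ (1 + d) ^ M = a ^ (1 + p ^ n) := by rw [pow_eq_pow_iff_modEq, ha]; exact hM
  rw [hM'] at hgM
  set x := g ^ M with hx
  have hpn : p ∣ p ^ n := by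
    refine dvd_pow_self p ?_
    rintro rfl
    exact hnd (by simpa using hd)
  have hpn2 : p = 2 → 4 ∣ p ^ n := by
    rintro rfl
    refine (pow_dvd_pow 2 (?_ : 2 ≤ n))
    by_contra! h
    exact hnd ((pow_dvd_pow 2 (show n + 1 ≤ 2 by omega)).trans (hd2 rfl))
  obtain ⟨u, hu, hpu⟩ := exists_geom_sum_eq_mul hpn hpn2
  have hxA : x ∉ Subgroup.zpowers a := by
    intro h
    obtain ⟨i, hi⟩ := h
    have : x * a * x⁻¹ = a := by rw [← hi]; simp only; group
    rw [hgM] at this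
    nth_rw 2 [← pow_one a] at this
    rw [pow_eq_pow_iff_modEq, ha] at this
    have h2 := (Nat.modEq_iff_dvd' (by omega)).1 this.symm
    rw [Nat.add_sub_cancel_left] at h2
    exact absurd (Nat.le_of_dvd (pow_pos hp.out.pos _) h2)
      (not_le.2 (Nat.pow_lt_pow_right hp.out.one_lt n.lt_succ_self))
  have hrp : (1 + p ^ n) ^ p = 1 + p ^ (n + 1) * u := by
    have := Commute.geom_sum₂_mul_add (Commute.all (p ^ n) 1) p
    simp only [one_pow, mul_one] at this
    rw [add_comm 1 (p ^ n)] at hu ⊢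
    rw [← this, hu]
    ring
  have hxp : x ^ p ∈ Subgroup.zpowers a := by
    refine hC _ ?_
    have := conj_pow_of_conj hgM p
    rw [hrp, pow_add, pow_mul, ← ha, pow_orderOf_eq_one, one_pow, mul_one, pow_one] at this
    exact mul_inv_eq_iff_eq_mul.1 this
  obtain ⟨s, hs⟩ := mem_powers_iff_mem_zpowers.2 hxp
  simp only at hs
  have hps : p ∣ s := by
    have h1 : x * a ^ s * x⁻¹ = a ^ s := by
      rw [hs]; group
    rw [← conj_pow, hgM, ← pow_mul, pow_eq_pow_iff_modEq, ha] at h1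
    have h2 := (Nat.modEq_iff_dvd' (by nlinarith [Nat.zero_le (p ^ n * s)])).1 h1.symm
    rw [add_mul, one_mul, Nat.add_sub_cancel_left, pow_succ,
      Nat.mul_dvd_mul_iff_left (pow_pos hp.out.pos _)] at h2
    exact h2
  obtain ⟨s, rfl⟩ := hps
  refine hT (hasTwist_of_zpowers_normal hP ha hA hxA hgM hs.symm hu hpu fun h ↦ hC _ ?_)
  obtain ⟨k, hk⟩ := exists_conj_eq_pow hA h
  have h1 : ∀ {y z : P} {i j : ℕ}, y * a * y⁻¹ = a ^ i → z * a * z⁻¹ = a ^ j →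
      (y * z) * a * (y * z)⁻¹ = a ^ (i * j) := fun {y z i j} hy hz ↦ by
    calc y * z * a * (y * z)⁻¹ = y * (z * a * z⁻¹) * y⁻¹ := by group
      _ = (y * a * y⁻¹) ^ j := by rw [hz, conj_pow]
      _ = _ := by rw [hy, pow_mul]
  have h2 := h1 hk hgM
  have h3 := h1 hgM hk
  rw [mul_comm] at h3
  have h4 : h * x * a * (h * x)⁻¹ = x * h * a * (x * h)⁻¹ := h2.trans h3.symm
  have h5 : Commute ((x * h)⁻¹ * (h * x)) a := by
    have : ((x * h)⁻¹ * (h * x)) * a * ((x * h)⁻¹ * (h * x))⁻¹ = a := by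
      calc _ = (x * h)⁻¹ * (h * x * a * (h * x)⁻¹) * (x * h) := by group
        _ = a := by rw [h4]; group
    exact mul_inv_eq_iff_eq_mul.1 this
  have h6 := hA.conj_mem _ (hC _ h5) (x * h)
  have h7 : h * x * h⁻¹ * x⁻¹ ∈ Subgroup.zpowers a := by
    convert h6 using 1
    group
  obtain ⟨i, hi⟩ := h7
  rw [← hi]
  exact ((Commute.refl a).zpow_left i).eq

end GroupTheory

section GroupTheory

variable {P : Type} [Group P]

theorem exists_maximal_zpowers_normal [Finite P] :
    ∃ a : P, (Subgroup.zpowers a).Normal ∧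
      ∀ b : P, (Subgroup.zpowers b).Normal → orderOf b ≤ orderOf a := by
  have : Nonempty {a : P // (Subgroup.zpowers a).Normal} :=
    ⟨⟨1, by rw [Subgroup.zpowers_one_eq_bot]; infer_instance⟩⟩
  obtain ⟨a, ha⟩ := Finite.exists_max fun a : {a : P // (Subgroup.zpowers a).Normal} ↦ orderOf a.1
  exact ⟨a, a.2, fun b hb ↦ ha ⟨b, hb⟩⟩

theorem zpowers_normal_of_mem_center {z : P} (hz : z ∈ Subgroup.center P) :
    (Subgroup.zpowers z).Normal := by
  refine ⟨fun b hb g ↦ ?_⟩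
  have := (Subgroup.mem_center_iff.1 (Subgroup.zpowers_le_of_mem hz hb)) g
  rwa [this, mul_inv_cancel_right]

theorem exists_cyclic_of_not_hasTwist {p : ℕ} [hp : Fact p.Prime] [Finite P] (hP : IsPGroup p P)
    (hT : ¬ HasTwist p P) :
    ∃ (a : P) (n : ℕ), orderOf a = p ^ n ∧ (Subgroup.zpowers a).Normal ∧
      ((∀ g, g ∈ Subgroup.zpowers a) ∨
        (p = 2 ∧ 2 ≤ n ∧ Nat.card P = 2 ^ (n + 1) ∧
          ∃ κ, (κ = 2 ^ n - 1 ∨ 3 ≤ n ∧ κ = 2 ^ (n - 1) - 1) ∧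
            ∀ g ∉ Subgroup.zpowers a, g * a * g⁻¹ = a ^ κ)) := by
  obtain ⟨a, hA, hmax⟩ := exists_maximal_zpowers_normal (P := P)
  obtain ⟨n, ha⟩ := IsPGroup.iff_orderOf.1 hP a
  refine ⟨a, n, ha, hA, ?_⟩
  rcases n with _ | n
  · left
    intro g
    by_contra hg
    have hPn : (⊤ : Subgroup P) ≠ ⊥ := fun h ↦ hg <| by
      have h1 : g ∈ (⊤ : Subgroup P) := Subgroup.mem_top g
      rw [h, Subgroup.mem_bot] at h1
      exact h1 ▸ one_mem _
    obtain ⟨c, -, hc, hc1, -⟩ := hP.exists_mem_center_of_normal ⊤ hPn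
    have h1 := hmax c (zpowers_normal_of_mem_center hc)
    rw [ha, pow_zero] at h1
    have h2 := orderOf_pos c
    exact hc1 (orderOf_eq_one_iff.1 (by omega))
  have hC : ∀ y : P, y * a = a * y → y ∈ Subgroup.zpowers a := fun y ↦
    mem_zpowers_of_commute hP hT ha hA hmax
  have hk : ∀ g : P, ∃ d, g * a * g⁻¹ = a ^ (1 + d) ∧ p ∣ d := fun g ↦ by
    obtain ⟨k, hk⟩ := exists_conj_eq_pow hA g
    have h1 : g * a * g⁻¹ = a ^ (1 + (k + (p ^ (n + 1) - 1))) := by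
      have := Nat.one_le_pow (n + 1) p hp.out.pos
      rw [show 1 + (k + (p ^ (n + 1) - 1)) = k + p ^ (n + 1) by omega, pow_add, ← ha,
        pow_orderOf_eq_one, mul_one, hk]
    have h2 := conj_exponent_modEq_one hP n.succ_ne_zero ha h1
    exact ⟨_, h1, by simpa using (Nat.modEq_iff_dvd' (by omega)).1 h2.symm⟩
  have hin : ∀ {g : P} {d : ℕ}, g * a * g⁻¹ = a ^ (1 + d) → p ∣ d → (p = 2 → 4 ∣ d) →
      g ∈ Subgroup.zpowers a := fun {g d} h1 h2 h3 ↦ by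
    have h4 := dvd_of_not_hasTwist hP hT ha hA hC h1 h2 h3
    rw [← ha, orderOf_dvd_iff_pow_eq_one] at h4
    rw [pow_add, h4, mul_one, pow_one] at h1
    exact hC g (mul_inv_eq_iff_eq_mul.1 h1)
  by_cases hall : ∀ g, g ∈ Subgroup.zpowers a
  · exact Or.inl hall
  right
  push Not at hall
  have hp2 : p = 2 := by
    obtain ⟨g, hg⟩ := hall
    by_contra hp2
    obtain ⟨d, h1, h2⟩ := hk g
    exact hg (hin h1 h2 fun h ↦ absurd h hp2)
  subst hp2
  have hd4 : ∀ {g : P} {d : ℕ}, g ∉ Subgroup.zpowers a → g * a * g⁻¹ = a ^ (1 + d) → 2 ∣ d →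
      d % 4 = 2 := fun {g d} hg h1 h2 ↦ by
    have : ¬ 4 ∣ d := fun h ↦ hg (hin h1 h2 fun _ ↦ h)
    omega
  have hmul : ∀ g ∉ Subgroup.zpowers a, ∀ h ∉ Subgroup.zpowers a, g * h ∈ Subgroup.zpowers a := by
    intro g hg h hh
    obtain ⟨d, h1, h2⟩ := hk g
    obtain ⟨d', h1', h2'⟩ := hk h
    have h3 := hd4 hg h1 h2
    have h4 := hd4 hh h1' h2'
    refine hin (d := d + d' + d * d') ?_ ?_ fun _ ↦ ?_
    · calc g * h * a * (g * h)⁻¹ = g * (h * a * h⁻¹) * g⁻¹ := by group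
        _ = (g * a * g⁻¹) ^ (1 + d') := by rw [h1', conj_pow]
        _ = _ := by rw [h1, ← pow_mul]; congr 1; ring
    · exact dvd_add (dvd_add h2 h2') (h2.mul_right _)
    · obtain ⟨x, rfl⟩ := h2
      obtain ⟨y, rfl⟩ := h2'
      obtain ⟨w, hw⟩ : 2 ∣ x + y := by omega
      exact ⟨w + x * y, by linear_combination 2 * hw⟩
  obtain ⟨g₀, hg₀⟩ := hall
  have hcoset : ∀ g ∉ Subgroup.zpowers a, g * a * g⁻¹ = g₀ * a * g₀⁻¹ := fun g hg ↦ by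
    obtain ⟨i, hi⟩ := hmul g₀⁻¹ (by simpa using hg₀) g hg
    have : g = g₀ * a ^ i := by
      have hi' : a ^ i = g₀⁻¹ * g := hi
      rw [hi']; group
    rw [this]; group
  have hcard : Nat.card P = 2 ^ (n + 1 + 1) := by
    have : (Subgroup.zpowers a).index = 2 := by
      rw [Subgroup.index_eq_two_iff]
      refine ⟨g₀, fun b ↦ ?_⟩
      by_cases hb : b ∈ Subgroup.zpowers a
      · exact Or.inr ⟨hb, by rwa [Subgroup.mul_mem_cancel_left _ hb]⟩
      · exact Or.inl ⟨hmul b hb g₀ hg₀, hb⟩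
    rw [← Subgroup.card_mul_index (Subgroup.zpowers a), this, Nat.card_zpowers, ha, ← pow_succ]
  obtain ⟨d, h1, h2⟩ := hk g₀
  have h3 := hd4 hg₀ h1 h2
  have hsq : 2 ^ (n + 1) ∣ d * (d + 2) := by
    have h4 := hmul g₀ hg₀ g₀ hg₀
    have h5 : (g₀ * g₀) * a * (g₀ * g₀)⁻¹ = a := by
      obtain ⟨i, hi⟩ := h4
      rw [← hi]
      simp only
      group
    have h6 := conj_pow_of_conj h1 2
    rw [pow_two, h5] at h6
    nth_rw 1 [← pow_one a] at h6
    rw [pow_eq_pow_iff_modEq, ha] at h6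
    have h7 := (Nat.modEq_iff_dvd' (Nat.one_le_pow _ _ (by omega))).1 h6
    convert h7 using 1
    rw [show (1 + d) ^ 2 = 1 + d * (d + 2) by ring, Nat.add_sub_cancel_left]
  have hn : 2 ^ n ∣ d + 2 := by
    obtain ⟨e, rfl⟩ := h2
    have he : (2 ^ n).Coprime e := by
      refine Nat.Coprime.pow_left _ ((Nat.Prime.coprime_iff_not_dvd Nat.prime_two).2 ?_)
      omega
    rw [pow_succ', mul_assoc, Nat.mul_dvd_mul_iff_left two_pos] at hsq
    exact he.dvd_of_dvd_mul_left hsq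
  have hex : ∀ {κ : ℕ}, g₀ * a * g₀⁻¹ = a ^ κ → ∀ g ∉ Subgroup.zpowers a, g * a * g⁻¹ = a ^ κ :=
    fun h g hg ↦ (hcoset g hg).trans h
  have hne : g₀ * a * g₀⁻¹ ≠ a := fun h ↦ hg₀ (hC _ (mul_inv_eq_iff_eq_mul.1 h))
  obtain ⟨c, hc⟩ := hn
  have hpos := Nat.one_le_two_pow (n := n)
  have hcase : g₀ * a * g₀⁻¹ = a ^ (2 ^ (n + 1) - 1) ∨ g₀ * a * g₀⁻¹ = a ^ (2 ^ n - 1) := by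
    rw [h1, pow_eq_pow_iff_modEq, pow_eq_pow_iff_modEq, ha]
    have e1 : 1 + d + 1 = 2 ^ n * c := by omega
    rcases Nat.even_or_odd' c with ⟨b, rfl | rfl⟩
    · left
      refine Nat.ModEq.add_right_cancel' 1 ?_
      rw [e1, Nat.sub_add_cancel Nat.one_le_two_pow, pow_succ, ← mul_assoc]
      simp [Nat.ModEq]
    · right
      refine Nat.ModEq.add_right_cancel' 1 ?_
      rw [e1, Nat.sub_add_cancel Nat.one_le_two_pow, mul_add, ← mul_assoc, ← pow_succ, mul_one]
      simp [Nat.ModEq]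
  have hn1 : n ≠ 0 := by
    rintro rfl
    have ha2 : a ^ 2 = 1 := by rw [← pow_one 2, ← zero_add 1, ← ha, pow_orderOf_eq_one]
    rcases hcase with h | h
    · exact hne (by simpa using h)
    · have h' : a = 1 := by simpa using h
      exact hne (by rw [h']; group)
  refine ⟨rfl, by omega, hcard, ?_⟩
  rcases hcase with h | h
  · exact ⟨_, Or.inl rfl, hex h⟩
  · refine ⟨2 ^ n - 1, Or.inr ⟨?_, by simp⟩, hex h⟩
    by_contra! h'
    have : n = 1 := by omega
    subst this
    exact hne (by simpa using h)

end GroupTheory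

/-- A nonzero representation over `ℂ` whose only equivariant endomorphisms are the scalars. -/
def IsSchur {P V : Type} [Group P] [AddCommGroup V] [Module ℂ V] (ρ : P →* Module.End ℂ V) : Prop :=
  Nontrivial V ∧ ∀ f : Module.End ℂ V, (∀ g, f * ρ g = ρ g * f) → ∃ c : ℂ, f = c • 1

/-- The projection onto the fixed vectors of an operator of finite order `m`. -/
noncomputable def fixedProj {R : Type} [Ring R] [Algebra ℂ R] (m : ℕ) (B : R) : R :=
  (m : ℂ)⁻¹ • ∑ i ∈ Finset.range m, B ^ i

section FixedProj

variable {R : Type} [Ring R] [Algebra ℂ R] {m : ℕ} {B : R}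

theorem mul_fixedProj (hB : B ^ m = 1) : B * fixedProj m B = fixedProj m B := by
  rw [fixedProj, mul_smul_comm, ← sub_eq_zero, ← smul_sub, ← sub_one_mul, mul_geom_sum, hB,
    sub_self, smul_zero]

theorem fixedProj_mul (hB : B ^ m = 1) : fixedProj m B * B = fixedProj m B := by
  rw [fixedProj, smul_mul_assoc, ← sub_eq_zero, ← smul_sub, ← mul_sub_one, geom_sum_mul, hB,
    sub_self, smul_zero]

theorem fixedProj_mul_of_mul_eq (hm : m ≠ 0) {X : R} (h : B * X = X) : fixedProj m B * X = X := by
  have h1 : ∀ i, B ^ i * X = X := fun i ↦ by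
    induction i with
    | zero => simp
    | succ i ih => rw [pow_succ, mul_assoc, h, ih]
  rw [fixedProj, smul_mul_assoc, Finset.sum_mul, Finset.sum_congr rfl fun i _ ↦ h1 i,
    Finset.sum_const, Finset.card_range, ← Nat.cast_smul_eq_nsmul ℂ, smul_smul,
    inv_mul_cancel₀ (by exact_mod_cast hm), one_smul]

theorem fixedProj_mul_self (hm : m ≠ 0) (hB : B ^ m = 1) :
    fixedProj m B * fixedProj m B = fixedProj m B :=
  fixedProj_mul_of_mul_eq hm (mul_fixedProj hB)

theorem fixedProj_mul_mul_eq_zero (hB : B ^ m = 1) {X : R} {c : ℂ} (hc : c ≠ 1)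
    (h : B * X = c • (X * B)) : fixedProj m B * X * fixedProj m B = 0 := by
  have h1 : fixedProj m B * X * fixedProj m B = c • (fixedProj m B * X * fixedProj m B) := by
    calc fixedProj m B * X * fixedProj m B = fixedProj m B * B * X * fixedProj m B := by
          rw [fixedProj_mul hB]
      _ = fixedProj m B * (B * X) * fixedProj m B := by rw [mul_assoc _ B]
      _ = c • (fixedProj m B * X * (B * fixedProj m B)) := by
          rw [h]; simp only [mul_smul_comm, smul_mul_assoc, mul_assoc]
      _ = _ := by rw [mul_fixedProj hB]
  have h2 : (1 - c) • (fixedProj m B * X * fixedProj m B) = 0 := by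
    rw [sub_smul, one_smul, ← h1, sub_self]
  exact (smul_eq_zero.1 h2).resolve_left (sub_ne_zero.2 hc.symm)

theorem commute_fixedProj {X : R} (h : Commute X B) : Commute X (fixedProj m B) :=
  (Commute.sum_right _ _ _ fun i _ ↦ h.pow_right i).smul_right _

end FixedProj

section Clifford

variable {P V : Type} [Group P] [AddCommGroup V] [Module ℂ V] {ρ : P →* Module.End ℂ V}

theorem IsSchur.exists_eq_smul_of_mem_center (hρ : IsSchur ρ) {z : P}
    (hz : z ∈ Subgroup.center P) : ∃ c : ℂ, ρ z = c • 1 :=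
  hρ.2 _ fun g ↦ by rw [← map_mul, ← map_mul, Subgroup.mem_center_iff.1 hz g]

open Classical in
theorem IsSchur.sum_conj [Fintype P] (hρ : IsSchur ρ) (T : Subgroup P) {π f : Module.End ℂ V}
    (hT : ∀ g ∉ T, π * ρ g * π = 0) (hf : π * f * π = f) (hTf : ∀ g ∈ T, f * ρ g = ρ g * f)
    (hππ : π * π = π) :
    ∃ c : ℂ, ∑ g, ρ g * f * ρ g⁻¹ = c • 1 ∧ (Nat.card T : ℂ) • f = c • π := by
  obtain ⟨c, hc⟩ := hρ.2 (∑ g, ρ g * f * ρ g⁻¹) fun h ↦ by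
    rw [Finset.sum_mul, Finset.mul_sum]
    refine Fintype.sum_equiv (Equiv.mulLeft h⁻¹) _ _ fun g ↦ ?_
    simp only [Equiv.coe_mulLeft, mul_inv_rev, inv_inv, map_mul, ← mul_assoc]
    rw [← map_mul ρ h, mul_inv_cancel, map_one, one_mul]
  refine ⟨c, hc, ?_⟩
  have h1 : π * (∑ g, ρ g * f * ρ g⁻¹) * π = c • π := by
    rw [hc, mul_smul_comm, smul_mul_assoc, mul_one, hππ]
  have hπf : π * f = f := by rw [← hf, ← mul_assoc, ← mul_assoc, hππ]
  have hfπ : f * π = f := by rw [← hf, mul_assoc, hππ]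
  rw [← h1, Finset.mul_sum, Finset.sum_mul]
  have h2 : ∀ g, π * (ρ g * f * ρ g⁻¹) * π = if g ∈ T then f else 0 := fun g ↦ by
    split_ifs with hg
    · rw [← hTf g hg, mul_assoc f, ← map_mul, mul_inv_cancel, map_one, mul_one, hf]
    · calc π * (ρ g * f * ρ g⁻¹) * π = π * ρ g * π * f * ρ g⁻¹ * π := by
            rw [mul_assoc (π * ρ g) π f, hπf]; simp only [mul_assoc]
        _ = 0 := by rw [hT g hg]; simp
  rw [Finset.sum_congr rfl fun g _ ↦ h2 g, ← Finset.sum_filter, Finset.sum_const,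
    Nat.cast_smul_eq_nsmul ℂ, Nat.card_eq_fintype_card, Fintype.card_subtype]

theorem IsSchur.exists_eq_smul [Finite P] (hρ : IsSchur ρ) (T : Subgroup P) {π f : Module.End ℂ V}
    (hT : ∀ g ∉ T, π * ρ g * π = 0) (hf : π * f * π = f) (hTf : ∀ g ∈ T, f * ρ g = ρ g * f)
    (hππ : π * π = π) : ∃ c : ℂ, f = c • π := by
  have := Fintype.ofFinite P
  obtain ⟨c, -, hc⟩ := hρ.sum_conj T hT hf hTf hππ
  have h0 : (Nat.card T : ℂ) ≠ 0 := by exact_mod_cast Nat.card_pos.ne'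
  exact ⟨(Nat.card T : ℂ)⁻¹ * c, by rw [mul_smul, ← hc, smul_smul, inv_mul_cancel₀ h0, one_smul]⟩

/-- The character formula for a representation induced from the range of `π`. -/
theorem IsSchur.card_mul_trace [Fintype P] (hρ : IsSchur ρ) (T : Subgroup P) {π : Module.End ℂ V}
    (hT : ∀ g ∉ T, π * ρ g * π = 0) (hTπ : ∀ g ∈ T, π * ρ g = ρ g * π)
    (hππ : π * π = π) (hπ : π ≠ 0) (h : P) :
    (Nat.card T : ℂ) * LinearMap.trace ℂ V (ρ h) =
      ∑ g, LinearMap.trace ℂ V (ρ (g⁻¹ * h * g) * π) := by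
  obtain ⟨c, hc, hc'⟩ := hρ.sum_conj T hT (by rw [hππ, hππ]) hTπ hππ
  obtain rfl : (Nat.card T : ℂ) = c := by
    rw [← sub_eq_zero, ← sub_smul] at hc'
    exact sub_eq_zero.1 ((smul_eq_zero.1 hc').resolve_right hπ)
  have : (Nat.card T : ℂ) • ρ h = ∑ g, ρ h * (ρ g * π * ρ g⁻¹) := by
    rw [← Finset.mul_sum, hc, mul_smul_comm, mul_one]
  rw [← smul_eq_mul, ← map_smul, this, map_sum]
  refine Finset.sum_congr rfl fun g _ ↦ ?_
  rw [← mul_assoc, LinearMap.trace_mul_comm]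
  simp only [map_mul, mul_assoc]

theorem trace_mul_proj_eq_zero (T : Subgroup P) {π : Module.End ℂ V}
    (hT : ∀ g ∉ T, π * ρ g * π = 0) (hππ : π * π = π) {g : P} (hg : g ∉ T) :
    LinearMap.trace ℂ V (ρ g * π) = 0 := by
  rw [← hππ, ← mul_assoc, LinearMap.trace_mul_comm, ← mul_assoc, hT g hg, map_zero]

end Clifford

section RangeRep

variable {P V : Type} [Group P] [AddCommGroup V] [Module ℂ V] {ρ : P →* Module.End ℂ V}

/-- The action of a subgroup on the range of an operator commuting with it. -/
def rangeRep (ρ : P →* Module.End ℂ V) (T : Subgroup P) (π : Module.End ℂ V)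
    (hTπ : ∀ g ∈ T, π * ρ g = ρ g * π) : T →* Module.End ℂ (LinearMap.range π) where
  toFun u := (ρ u).restrict (p := LinearMap.range π) (q := LinearMap.range π) <| by
    rintro _ ⟨y, rfl⟩
    exact ⟨ρ u y, LinearMap.congr_fun (hTπ u u.2) y⟩
  map_one' := by ext; simp
  map_mul' u v := by ext; simp

theorem coe_rangeRep_apply (T : Subgroup P) (π : Module.End ℂ V)
    (hTπ : ∀ g ∈ T, π * ρ g = ρ g * π) (u : T) (w : LinearMap.range π) :
    (rangeRep ρ T π hTπ u w : V) = ρ u w := rfl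

theorem trace_rangeRep [FiniteDimensional ℂ V] (T : Subgroup P) {π : Module.End ℂ V}
    (hTπ : ∀ g ∈ T, π * ρ g = ρ g * π) (hππ : π * π = π) (u : T) :
    LinearMap.trace ℂ _ (rangeRep ρ T π hTπ u) = LinearMap.trace ℂ V (ρ u * π) := by
  have h : ∀ x, (ρ u * π) x ∈ LinearMap.range π := fun x ↦ by
    rw [← hTπ u u.2]; exact ⟨ρ u x, rfl⟩
  rw [← LinearMap.trace_restrict_eq_of_forall_mem (LinearMap.range π) (ρ u * π) h]
  congr 1
  ext ⟨_, y, rfl⟩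
  rw [coe_rangeRep_apply, LinearMap.coe_restrict_apply]
  exact congrArg (ρ u) (LinearMap.congr_fun hππ y).symm

theorem isSchur_rangeRep [Finite P] (hρ : IsSchur ρ) (T : Subgroup P) {π : Module.End ℂ V}
    (hT : ∀ g ∉ T, π * ρ g * π = 0) (hTπ : ∀ g ∈ T, π * ρ g = ρ g * π)
    (hππ : π * π = π) (hπ : π ≠ 0) : IsSchur (rangeRep ρ T π hTπ) := by
  have hfix : ∀ w : LinearMap.range π, π w = w := by
    rintro ⟨_, y, rfl⟩
    exact LinearMap.congr_fun hππ y
  refine ⟨?_, fun f hf ↦ ?_⟩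
  · rw [Submodule.nontrivial_iff_ne_bot, Ne, LinearMap.range_eq_bot]
    exact hπ
  · have hF : ∀ x, ((LinearMap.range π).subtype ∘ₗ f ∘ₗ π.rangeRestrict : Module.End ℂ V) x =
        f (π.rangeRestrict x) := fun x ↦ rfl
    set F : Module.End ℂ V := (LinearMap.range π).subtype ∘ₗ f ∘ₗ π.rangeRestrict with hFdef
    have hF1 : π * F * π = F := by
      ext x
      have h2 : π.rangeRestrict (π x) = π.rangeRestrict x :=
        Subtype.ext (LinearMap.congr_fun hππ x)
      simp only [Module.End.mul_apply]
      rw [hF, hF, hfix, h2]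
    have hF2 : ∀ g ∈ T, F * ρ g = ρ g * F := fun g hg ↦ by
      ext x
      have h1 := congrArg (Subtype.val) (LinearMap.congr_fun (hf ⟨g, hg⟩) (π.rangeRestrict x))
      have h2 : π.rangeRestrict (ρ g x) = rangeRep ρ T π hTπ ⟨g, hg⟩ (π.rangeRestrict x) :=
        Subtype.ext (LinearMap.congr_fun (hTπ g hg) x)
      simp only [Module.End.mul_apply] at h1 ⊢
      rw [hF, h2, h1]
      rfl
    obtain ⟨c, hc⟩ := hρ.exists_eq_smul T hT hF1 hF2 hππ
    refine ⟨c, ?_⟩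
    ext w
    have h1 : F w = c • (w : V) := by rw [hc, LinearMap.smul_apply, hfix]
    have h2 : π.rangeRestrict (w : V) = w := Subtype.ext (hfix w)
    rw [hF, h2] at h1
    simpa using h1

theorem IsSchur.of_comp {Q : Type} [Group Q] {f : P →* Q} {σ : Q →* Module.End ℂ V}
    (h : IsSchur (σ.comp f)) : IsSchur σ :=
  ⟨h.1, fun x hx ↦ h.2 x fun g ↦ hx (f g)⟩

end RangeRep

/-- The additive subgroup of `ℂ` spanned by the values of a function. -/
def valueSpan {P : Type} (χ : P → ℂ) : AddSubgroup ℂ := AddSubgroup.closure (Set.range χ)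

/-- The row of the character table belonging to `χ` has conductor `p ^ n`, and `ℤ`-spans a large
subgroup of either the ring of integers of the `p ^ n`-th cyclotomic field, or of the subring
fixed by an involution `ζ ↦ ζ ^ κ`. -/
def RowProperty {P : Type} [Group P] (p N : ℕ) (χ : P → ℂ) : Prop :=
  ∃ n j : ℕ, (n = 0 → ∀ g, χ g = χ 1) ∧
    ((2 * j + n ≤ N ∧ (∀ z : ℂ, z ^ p ^ n = 1 → p ^ j * z ∈ valueSpan χ) ∧
        ∀ k, k ≡ 1 [MOD p ^ n] → ∀ g, χ (g ^ k) = χ g) ∨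
      (p = 2 ∧ 2 ≤ n ∧ 2 * j + n + 1 ≤ N ∧ ∃ κ,
        (κ = 2 ^ n - 1 ∨ 3 ≤ n ∧ κ = 2 ^ (n - 1) - 1) ∧
        (∀ z : ℂ, z ^ 2 ^ n = 1 → 2 ^ j * (z + z ^ κ) ∈ valueSpan χ) ∧
        ∀ k, (k ≡ 1 [MOD 2 ^ n] ∨ k ≡ κ [MOD 2 ^ n]) → ∀ g, χ (g ^ k) = χ g))

theorem RowProperty.comp {P Q : Type} [Group P] [Group Q] {p N N' : ℕ} (hN : N' ≤ N) {χ : Q → ℂ}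
    (f : P →* Q) (hf : Function.Surjective f) (h : RowProperty p N' χ) :
    RowProperty p N (χ ∘ f) := by
  have hspan : valueSpan (χ ∘ f) = valueSpan χ := by
    rw [valueSpan, valueSpan, hf.range_comp]
  obtain ⟨n, j, h0, h⟩ := h
  refine ⟨n, j, fun hn g ↦ by simpa using h0 hn (f g), ?_⟩
  rw [hspan]
  rcases h with ⟨h1, h2, h3⟩ | ⟨h1, h2, h3, κ, h4, h5, h6⟩
  · exact Or.inl ⟨h1.trans hN, h2, fun k hk g ↦ by simpa using h3 k hk (f g)⟩
  · exact Or.inr ⟨h1, h2, h3.trans hN, κ, h4, h5, fun k hk g ↦ by simpa using h6 k hk (f g)⟩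

theorem odd_of_kappa {n κ : ℕ} (hn : 2 ≤ n) (h : κ = 2 ^ n - 1 ∨ 3 ≤ n ∧ κ = 2 ^ (n - 1) - 1) :
    Odd κ := by
  have : ∀ m, m ≠ 0 → Odd (2 ^ m - 1) := fun m hm ↦
    Nat.Even.sub_odd Nat.one_le_two_pow ((Nat.even_pow' hm).2 even_two) odd_one
  rcases h with rfl | ⟨h, rfl⟩
  · exact this _ (by omega)
  · exact this _ (by omega)

/-- Transfer of `RowProperty` from a section `T` of `P` to `P`, raising the exponent bound by 2. -/
theorem RowProperty.of_induced {P T : Type} [Group P] [Group T] {p N : ℕ} [hp : Fact p.Prime]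
    {χ : P → ℂ} {ψ : T → ℂ} (h : RowProperty p N ψ) (hψ : ∃ t, ψ t ≠ ψ 1)
    (hspan : ∀ t, p * ψ t ∈ valueSpan χ)
    (hstab : ∀ k, p.Coprime k → (∀ t, ψ (t ^ k) = ψ t) → ∀ g, χ (g ^ k) = χ g) :
    RowProperty p (N + 2) χ := by
  have hsp : ∀ x ∈ valueSpan ψ, p * x ∈ valueSpan χ := fun x hx ↦ by
    have : valueSpan ψ ≤ (valueSpan χ).comap (AddMonoidHom.mulLeft (p : ℂ)) := by
      refine (AddSubgroup.closure_le _).2 ?_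
      rintro _ ⟨t, rfl⟩
      exact hspan t
    exact this hx
  obtain ⟨n, j, h0, h⟩ := h
  have hn : n ≠ 0 := fun hn ↦ by
    obtain ⟨t, ht⟩ := hψ
    exact ht (h0 hn t)
  refine ⟨n, j + 1, fun h ↦ absurd h hn, ?_⟩
  have hcop : ∀ k, k ≡ 1 [MOD p ^ n] → p.Coprime k := fun k hk ↦ by
    have := (hk.of_dvd (dvd_pow_self p hn)).gcd_eq
    simpa [Nat.Coprime, Nat.gcd_comm] using this
  rcases h with ⟨h1, h2, h3⟩ | ⟨rfl, h2, h3, κ, h4, h5, h6⟩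
  · refine Or.inl ⟨by omega, fun z hz ↦ ?_, fun k hk ↦ hstab k (hcop k hk) (h3 k hk)⟩
    rw [pow_succ', mul_assoc]
    exact hsp _ (h2 z hz)
  · refine Or.inr ⟨rfl, h2, by omega, κ, h4, fun z hz ↦ ?_,
      fun k hk ↦ hstab k ?_ (h6 k hk)⟩
    · rw [pow_succ', mul_assoc]
      exact_mod_cast hsp _ (h5 z hz)
    · rcases hk with hk | hk
      · exact hcop k hk
      · have := (hk.of_dvd (dvd_pow_self 2 hn))
        have h7 := odd_of_kappa h2 h4
        rw [Nat.coprime_two_left, Nat.odd_iff]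
        rw [Nat.odd_iff] at h7
        unfold Nat.ModEq at this
        omega

section Row

variable {P V : Type} [Group P] [AddCommGroup V] [Module ℂ V] {ρ : P →* Module.End ℂ V}

theorem fixedProj_apply_of_apply_eq {m : ℕ} (hm : m ≠ 0) {B : Module.End ℂ V} {w : V}
    (h : B w = w) : fixedProj m B w = w := by
  have h1 : ∀ i, (B ^ i) w = w := fun i ↦ by
    induction i with
    | zero => simp
    | succ i ih => rw [pow_succ, Module.End.mul_apply, h, ih]
  rw [fixedProj, LinearMap.smul_apply, LinearMap.sum_apply, Finset.sum_congr rfl fun i _ ↦ h1 i,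
    Finset.sum_const, Finset.card_range, ← Nat.cast_smul_eq_nsmul ℂ, smul_smul,
    inv_mul_cancel₀ (by exact_mod_cast hm), one_smul]

theorem smul_one_injective [Nontrivial V] {c d : ℂ} (h : c • (1 : Module.End ℂ V) = d • 1) :
    c = d := smul_left_injective ℂ one_ne_zero h

theorem pow_eq_one_of_smul_one [Nontrivial V] {x : P} {c : ℂ} {m : ℕ} (h : ρ x = c • 1)
    (hx : x ^ m = 1) : c ^ m = 1 := by
  refine smul_one_injective (V := V) ?_
  have := congrArg ρ hx
  rwa [map_pow, h, smul_pow, one_pow, map_one, ← one_smul ℂ (1 : Module.End ℂ V), smul_smul,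
    mul_one] at this

theorem RowProperty.mono {p N N' : ℕ} (hN : N' ≤ N) {χ : P → ℂ} (h : RowProperty p N' χ) :
    RowProperty p N χ :=
  h.comp hN (MonoidHom.id P) Function.surjective_id

theorem mem_of_pow_mem_of_coprime {T : Subgroup P} {p N k : ℕ} (hcard : Nat.card P = p ^ N)
    (hk : p.Coprime k) {x : P} (hx : x ^ k ∈ T) : x ∈ T := by
  have h1 : k.Coprime (orderOf x) :=
    ((hk.pow_left N).coprime_dvd_left (hcard ▸ orderOf_dvd_natCard x)).symm
  obtain ⟨m, hm⟩ := exists_pow_eq_self_of_coprime h1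
  exact hm ▸ pow_mem hx m

theorem rowProperty_of_hasTwist {p : ℕ} [hp : Fact p.Prime] [Finite P] [FiniteDimensional ℂ V]
    (hρ : IsSchur ρ) (hinj : Function.Injective ρ) (hT : HasTwist p P) {N : ℕ}
    (hcard : Nat.card P = p ^ N)
    (ih : ∀ N' < N, ∀ (Q W : Type) [Group Q] [Finite Q] [AddCommGroup W] [Module ℂ W]
      [FiniteDimensional ℂ W] (σ : Q →* Module.End ℂ W), Nat.card Q = p ^ N' → IsSchur σ →
        RowProperty p N' fun q ↦ LinearMap.trace ℂ W (σ q)) :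
    RowProperty p N fun g ↦ LinearMap.trace ℂ V (ρ g) := by
  have hVn : Nontrivial V := hρ.1
  obtain ⟨z, e, hz, hz1, hzp, hep, hez, hconj⟩ := hT
  obtain ⟨ω, hω⟩ := hρ.exists_eq_smul_of_mem_center hz
  have hω1 : ω ≠ 1 := fun h ↦ hz1 <| hinj <| by rw [hω, h, one_smul, map_one]
  have hωp : ω ^ p = 1 := pow_eq_one_of_smul_one hω hzp
  have hzi : ∀ i : ℕ, ρ (z ^ i) = ω ^ i • 1 := fun i ↦ by rw [map_pow, hω, smul_pow, one_pow]
  let T : Subgroup P := Subgroup.centralizer {e}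
  have hmemT : ∀ {g}, g ∈ T ↔ g * e = e * g := fun {g} ↦ Subgroup.mem_centralizer_singleton_iff
  have key : ∀ g, ∃ i : ℕ, ρ e * ρ g = ω ^ i • (ρ g * ρ e) ∧ (g ∉ T → ω ^ i ≠ 1) := fun g ↦ by
    obtain ⟨i, hi⟩ := mem_powers_iff_mem_zpowers.2 (hconj g⁻¹)
    have h1 : ρ e * ρ g = ω ^ i • (ρ g * ρ e) := by
      have h2 : e * g = g * (z ^ i * e) := by
        simp only at hi
        rw [hi]; group
      rw [← map_mul, h2, map_mul, map_mul, hzi, smul_mul_assoc, one_mul, mul_smul_comm]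
    refine ⟨i, h1, fun hg h3 ↦ hg (hmemT.2 (hinj ?_))⟩
    rw [map_mul, map_mul, h1, h3, one_smul]
  have hB : ρ e ^ p = 1 := by rw [← map_pow, hep, map_one]
  have hp0 : p ≠ 0 := hp.out.ne_zero
  obtain ⟨π, hπdef⟩ : ∃ π, π = fixedProj p (ρ e) := ⟨_, rfl⟩
  have hππ : π * π = π := by rw [hπdef, fixedProj_mul_self hp0 hB]
  have hTz : ∀ g ∉ T, π * ρ g * π = 0 := fun g hg ↦ by
    obtain ⟨i, hi, hi1⟩ := key g
    rw [hπdef]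
    exact fixedProj_mul_mul_eq_zero hB (hi1 hg) hi
  have hTπ : ∀ g ∈ T, π * ρ g = ρ g * π := fun g hg ↦ by
    have h1 : Commute (ρ g) (ρ e) := by
      rw [Commute, SemiconjBy, ← map_mul, ← map_mul, hmemT.1 hg]
    rw [hπdef]
    exact (commute_fixedProj h1).eq.symm
  obtain ⟨g₀, hg₀⟩ : ∃ g, g ∉ T := by
    by_contra! h
    have hec : e ∈ Subgroup.center P := Subgroup.mem_center_iff.2 fun g ↦ hmemT.1 (h g)
    obtain ⟨c, hc⟩ := hρ.exists_eq_smul_of_mem_center hec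
    have hcp : c ^ p = 1 := pow_eq_one_of_smul_one hc hep
    have hprim : IsPrimitiveRoot ω p := IsPrimitiveRoot.iff_orderOf.2 (orderOf_eq_prime hωp hω1)
    obtain ⟨i, -, hi⟩ := hprim.eq_pow_of_pow_eq_one hcp
    refine hez ⟨i, hinj ?_⟩
    simp only [zpow_natCast]
    rw [hzi, hi, hc]
  have hπ0 : π ≠ 0 := by
    obtain ⟨i, hi, hi1⟩ := key g₀
    set η := ω ^ i
    have hprim : IsPrimitiveRoot η p :=
      IsPrimitiveRoot.iff_orderOf.2 (orderOf_eq_prime (by rw [pow_right_comm, hωp, one_pow])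
        (hi1 hg₀))
    have hpow : ∀ t : ℕ, ρ e * ρ g₀ ^ t = η ^ t • (ρ g₀ ^ t * ρ e) := fun t ↦ by
      induction t with
      | zero => simp
      | succ t ih =>
        rw [pow_succ, ← mul_assoc, ih, smul_mul_assoc, mul_assoc, hi, mul_smul_comm, smul_smul,
          ← pow_succ, ← mul_assoc]
    obtain ⟨μ, hμ⟩ := Module.End.exists_eigenvalue (ρ e)
    obtain ⟨v, hv⟩ := hμ.exists_hasEigenvector
    have hμp : μ ^ p = 1 := by
      have h1 := hv.pow_apply p
      rw [hB, Module.End.one_apply] at h1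
      exact smul_left_injective ℂ hv.2 (by simpa using h1.symm)
    obtain ⟨t, -, ht⟩ := hprim.eq_pow_of_pow_eq_one (ξ := μ⁻¹) (by rw [inv_pow, hμp, inv_one])
    have hμ0 : μ ≠ 0 := by
      rintro rfl
      simp [hp0] at hμp
    have hw : ρ e ((ρ g₀ ^ t) v) = (ρ g₀ ^ t) v := by
      rw [← Module.End.mul_apply, hpow, LinearMap.smul_apply, Module.End.mul_apply,
        hv.apply_eq_smul, map_smul, smul_smul, ht, inv_mul_cancel₀ hμ0, one_smul]
    intro h0
    have h1 := fixedProj_apply_of_apply_eq hp0 hw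
    rw [← hπdef, h0, LinearMap.zero_apply, ← map_pow] at h1
    have h2 := congrArg (ρ (g₀ ^ t)⁻¹) h1
    rw [map_zero, ← Module.End.mul_apply, ← map_mul, inv_mul_cancel, map_one] at h2
    exact hv.2 h2.symm
  have heT : e ∈ T := hmemT.2 rfl
  let e' : T := ⟨e, heT⟩
  have he'c : e' ∈ Subgroup.center T :=
    Subgroup.mem_center_iff.2 fun g ↦ Subtype.ext (hmemT.1 g.2)
  have hNn : (Subgroup.zpowers e').Normal := zpowers_normal_of_mem_center he'c
  let τ := rangeRep ρ T π hTπ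
  have hker : ∀ x ∈ Subgroup.zpowers e', τ x = 1 := by
    have : Subgroup.zpowers e' ≤ τ.ker := by
      refine Subgroup.zpowers_le_of_mem ?_
      rw [MonoidHom.mem_ker]
      ext ⟨_, y, rfl⟩
      rw [coe_rangeRep_apply]
      change ρ e (π y) = π y
      rw [← Module.End.mul_apply, hπdef, mul_fixedProj hB]
    exact this
  let σ := QuotientGroup.lift (Subgroup.zpowers e') τ hker
  have hσ : IsSchur σ := IsSchur.of_comp (f := QuotientGroup.mk' (Subgroup.zpowers e'))
    (isSchur_rangeRep hρ T hTz hTπ hππ hπ0)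
  have hψ : ∀ u : T, LinearMap.trace ℂ _ (σ (QuotientGroup.mk u)) = LinearMap.trace ℂ V (ρ u * π) :=
    fun u ↦ trace_rangeRep T hTπ hππ u
  obtain ⟨N', hN', hQ⟩ : ∃ N', N' + 2 ≤ N ∧ Nat.card (T ⧸ Subgroup.zpowers e') = p ^ N' := by
    have h1 := Subgroup.card_mul_index T
    have h2 := Subgroup.card_eq_card_quotient_mul_card_subgroup (Subgroup.zpowers e')
    have h3 : orderOf e' = p := by
      refine orderOf_eq_prime (Subtype.ext hep) fun h ↦ hez ?_
      have : e = 1 := congrArg Subtype.val h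
      rw [this]; exact one_mem _
    rw [Nat.card_zpowers, h3] at h2
    rw [hcard] at h1
    obtain ⟨M, -, hM⟩ := (Nat.dvd_prime_pow hp.out).1 (Dvd.intro _ h1)
    obtain ⟨I, -, hI⟩ := (Nat.dvd_prime_pow hp.out).1 (Dvd.intro_left _ h1)
    obtain ⟨N', -, hN'⟩ := (Nat.dvd_prime_pow hp.out).1 (Dvd.intro _ (h2.symm.trans hM))
    have hI0 : I ≠ 0 := by
      rintro rfl
      rw [pow_zero, Subgroup.index_eq_one] at hI
      exact hg₀ (hI ▸ Subgroup.mem_top _)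
    refine ⟨N', ?_, hN'⟩
    rw [hN', hM, ← pow_succ] at h2
    rw [hM, hI, ← pow_add] at h1
    have h4 := Nat.pow_right_injective hp.out.two_le h1
    have h5 := Nat.pow_right_injective hp.out.two_le h2
    omega
  refine RowProperty.mono hN' (RowProperty.of_induced (ih N' (by omega) _ _ σ hQ hσ) ?_ ?_ ?_)
  · have hzT : z ∈ T := hmemT.2 (Subgroup.mem_center_iff.1 hz e).symm
    refine ⟨QuotientGroup.mk ⟨z, hzT⟩, fun h ↦ ?_⟩
    have h1 := hψ ⟨z, hzT⟩
    have h2 := hψ 1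
    rw [hω, smul_mul_assoc, one_mul, map_smul] at h1
    rw [OneMemClass.coe_one, map_one, one_mul] at h2
    rw [h1] at h
    change _ = LinearMap.trace ℂ _ (σ (QuotientGroup.mk 1)) at h
    rw [h2] at h
    have h3 : LinearMap.trace ℂ V π ≠ 0 := by
      rw [← h2, QuotientGroup.mk_one, map_one, LinearMap.trace_one]
      have := hσ.1
      exact_mod_cast Module.finrank_pos.ne'
    refine hω1 (mul_right_cancel₀ h3 ?_)
    rw [one_mul, ← smul_eq_mul, h]
  · intro t
    obtain ⟨u, rfl⟩ := QuotientGroup.mk_surjective t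
    rw [hψ, hπdef, fixedProj, mul_smul_comm, map_smul, smul_eq_mul, mul_inv_cancel_left₀
      (by exact_mod_cast hp0), Finset.mul_sum, map_sum]
    refine sum_mem fun i _ ↦ AddSubgroup.subset_closure ⟨u * e ^ i, ?_⟩
    simp only [map_mul, map_pow]
  · intro k hk hst h
    have := Fintype.ofFinite P
    have hT0 : (Nat.card T : ℂ) ≠ 0 := by exact_mod_cast Nat.card_pos.ne'
    refine mul_left_cancel₀ hT0 ?_
    rw [hρ.card_mul_trace T hTz hTπ hππ hπ0, hρ.card_mul_trace T hTz hTπ hππ hπ0]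
    refine Finset.sum_congr rfl fun g _ ↦ ?_
    have h1 : g⁻¹ * h ^ k * g = (g⁻¹ * h * g) ^ k := by
      have := conj_pow (i := k) (a := g⁻¹) (b := h)
      rw [inv_inv] at this
      exact this.symm
    rw [h1]
    by_cases hx : g⁻¹ * h * g ∈ T
    · have := hst (QuotientGroup.mk ⟨_, hx⟩)
      rw [← QuotientGroup.mk_pow, hψ, hψ] at this
      exact this
    · rw [trace_mul_proj_eq_zero T hTz hππ hx, trace_mul_proj_eq_zero T hTz hππ
        fun h ↦ hx (mem_of_pow_mem_of_coprime hcard hk h)]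

end Row

theorem kappa_sq_modEq_one {n κ : ℕ} (hn : 2 ≤ n)
    (h : κ = 2 ^ n - 1 ∨ 3 ≤ n ∧ κ = 2 ^ (n - 1) - 1) : κ * κ ≡ 1 [MOD 2 ^ n] := by
  have key : ∀ m : ℕ, m ≠ 0 → (2 ^ m - 1) * (2 ^ m - 1) + 2 ^ (m + 1) = 1 + 2 ^ (m + m) :=
      fun m hm ↦ by
    obtain ⟨c, hc⟩ : ∃ c, 2 ^ m = c + 1 := ⟨2 ^ m - 1, (Nat.sub_add_cancel Nat.one_le_two_pow).symm⟩
    rw [pow_add 2 m m, pow_succ, hc, Nat.add_sub_cancel]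
    ring
  have key2 : ∀ m : ℕ, m ≠ 0 → n ≤ m + 1 → (2 ^ m - 1) * (2 ^ m - 1) ≡ 1 [MOD 2 ^ n] :=
      fun m hm hmn ↦ by
    have h1 : 2 ^ (m + 1) ≡ 0 [MOD 2 ^ n] := Nat.modEq_zero_iff_dvd.2 (pow_dvd_pow 2 hmn)
    have h2 : 2 ^ (m + m) ≡ 0 [MOD 2 ^ n] := Nat.modEq_zero_iff_dvd.2 (pow_dvd_pow 2 (by omega))
    refine Nat.ModEq.add_right_cancel h1 ?_
    rw [key m hm]
    exact h2.add_left 1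
  rcases h with rfl | ⟨h, rfl⟩
  · exact key2 n (by omega) (by omega)
  · exact key2 (n - 1) (by omega) (by omega)

section Row

variable {P V : Type} [Group P] [AddCommGroup V] [Module ℂ V] {ρ : P →* Module.End ℂ V}

theorem trace_proj_eq_one [Finite P] [FiniteDimensional ℂ V] (hρ : IsSchur ρ) {a : P} {ζ : ℂ}
    {π : Module.End ℂ V} (hT : ∀ g ∉ Subgroup.zpowers a, π * ρ g * π = 0) (hππ : π * π = π)
    (h1 : ρ a * π = ζ • π) (h2 : π * ρ a = ζ • π) {v : V} (hv : v ≠ 0) (hπv : π v = v) :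
    LinearMap.trace ℂ V π = 1 := by
  obtain ⟨φ, hφ⟩ := Module.Projective.exists_dual_ne_zero ℂ hv
  set F : Module.End ℂ V := π * φ.smulRight v * π with hF
  have hFa : Commute F (ρ a) := by
    rw [Commute, SemiconjBy, hF, mul_assoc, h2, mul_smul_comm, ← mul_assoc, ← mul_assoc, h1,
      smul_mul_assoc, smul_mul_assoc]
  have hFg : ∀ g ∈ Subgroup.zpowers a, F * ρ g = ρ g * F := by
    intro g hg
    obtain ⟨i, rfl⟩ := (mem_powers_iff_mem_zpowers (x := a)).2 hg
    simp only [map_pow]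
    exact (hFa.pow_right i).eq
  have hF1 : π * F * π = F := by
    rw [hF]
    calc π * (π * φ.smulRight v * π) * π = (π * π) * φ.smulRight v * (π * π) := by
          simp only [mul_assoc]
      _ = _ := by rw [hππ]
  obtain ⟨c, hc⟩ := hρ.exists_eq_smul (Subgroup.zpowers a) hT hF1 hFg hππ
  have hcφ : φ v = c := by
    have h3 := LinearMap.congr_fun hc v
    rw [hF, Module.End.mul_apply, Module.End.mul_apply, LinearMap.smul_apply, hπv,
      LinearMap.smulRight_apply, map_smul, hπv] at h3
    exact smul_left_injective ℂ hv h3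
  have h4 : LinearMap.trace ℂ V F = φ v := by
    rw [hF, LinearMap.trace_mul_comm, ← mul_assoc, hππ, LinearMap.trace_mul_comm]
    have : φ.smulRight v * π = (φ ∘ₗ π).smulRight v := rfl
    rw [this, LinearMap.trace_smulRight, LinearMap.comp_apply, hπv]
  rw [hc, map_smul, smul_eq_mul, hcφ] at h4
  exact mul_left_cancel₀ (hcφ ▸ hφ) (h4.trans (mul_one c).symm)

theorem isPrimitiveRoot_of_eigenvector {p : ℕ} [hp : Fact p.Prime] [Finite P] (hP : IsPGroup p P)
    (hρ : IsSchur ρ) (hinj : Function.Injective ρ) {a : P} {n : ℕ} (ha : orderOf a = p ^ n)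
    (hA : (Subgroup.zpowers a).Normal) {ζ : ℂ} {v : V} (hv : v ≠ 0) (hζ : ρ a v = ζ • v) :
    IsPrimitiveRoot ζ (p ^ n) := by
  have hpow : ∀ i, ρ (a ^ i) v = ζ ^ i • v := fun i ↦ by
    induction i with
    | zero => simp
    | succ i ih => rw [pow_succ, map_mul, Module.End.mul_apply, hζ, map_smul, ih, smul_smul,
        pow_succ']
  have hζ1 : ζ ^ p ^ n = 1 := by
    have h1 := hpow (p ^ n)
    rw [← ha, pow_orderOf_eq_one, map_one, Module.End.one_apply] at h1
    exact smul_left_injective ℂ hv (by simpa [ha] using h1.symm)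
  rcases n with _ | n
  · have : ζ = 1 := by simpa using hζ1
    simp [this]
  rw [IsPrimitiveRoot.iff_orderOf]
  refine orderOf_eq_prime_pow (fun h ↦ ?_) hζ1
  obtain ⟨c, hc⟩ := hρ.exists_eq_smul_of_mem_center (pow_mem_center_of_zpowers_normal hP ha hA)
  have h1 := hpow (p ^ n)
  rw [h, hc, LinearMap.smul_apply, Module.End.one_apply] at h1
  have hc1 : c = 1 := smul_left_injective ℂ hv h1
  have h2 : a ^ p ^ n = 1 := hinj (by rw [hc, hc1, one_smul, map_one])
  rw [← orderOf_dvd_iff_pow_eq_one, ha] at h2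
  exact absurd (Nat.le_of_dvd (pow_pos hp.out.pos _) h2)
    (not_le.2 (Nat.pow_lt_pow_right hp.out.one_lt n.lt_succ_self))

theorem rowProperty_of_not_hasTwist {p : ℕ} [hp : Fact p.Prime] [Finite P] [FiniteDimensional ℂ V]
    (hρ : IsSchur ρ) (hinj : Function.Injective ρ) (hT : ¬ HasTwist p P) {N : ℕ}
    (hcard : Nat.card P = p ^ N) : RowProperty p N fun g ↦ LinearMap.trace ℂ V (ρ g) := by
  have hP : IsPGroup p P := IsPGroup.of_card hcard
  have hVn : Nontrivial V := hρ.1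
  have := Fintype.ofFinite P
  obtain ⟨a, n, ha, hA, hcase⟩ := exists_cyclic_of_not_hasTwist hP hT
  obtain ⟨ζ, hζ⟩ := Module.End.exists_eigenvalue (ρ a)
  obtain ⟨v, hv⟩ := hζ.exists_hasEigenvector
  have hprim := isPrimitiveRoot_of_eigenvector hP hρ hinj ha hA hv.2 hv.apply_eq_smul
  have hpn : p ^ n ≠ 0 := pow_ne_zero _ hp.out.ne_zero
  have hζ0 : ζ ≠ 0 := hprim.ne_zero hpn
  obtain ⟨B, hBdef⟩ : ∃ B, B = ζ⁻¹ • ρ a := ⟨_, rfl⟩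
  have hB : B ^ p ^ n = 1 := by
    rw [hBdef, smul_pow, inv_pow, hprim.pow_eq_one, inv_one, one_smul, ← map_pow, ← ha,
      pow_orderOf_eq_one, map_one]
  have haB : ρ a = ζ • B := by rw [hBdef, smul_smul, mul_inv_cancel₀ hζ0, one_smul]
  obtain ⟨π, hπdef⟩ : ∃ π, π = fixedProj (p ^ n) B := ⟨_, rfl⟩
  have hππ : π * π = π := by rw [hπdef, fixedProj_mul_self hpn hB]
  have haπ : ρ a * π = ζ • π := by rw [haB, hπdef, smul_mul_assoc, mul_fixedProj hB]
  have hπa : π * ρ a = ζ • π := by rw [haB, hπdef, mul_smul_comm, fixedProj_mul hB]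
  have hπv : π v = v := by
    rw [hπdef]
    refine fixedProj_apply_of_apply_eq hpn ?_
    rw [hBdef, LinearMap.smul_apply, hv.apply_eq_smul, smul_smul, inv_mul_cancel₀ hζ0, one_smul]
  have hπ0 : π ≠ 0 := by
    intro h
    rw [h, LinearMap.zero_apply] at hπv
    exact hv.2 hπv.symm
  have hpow : ∀ i : ℕ, ρ (a ^ i) * π = ζ ^ i • π := fun i ↦ by
    induction i with
    | zero => simp
    | succ i ih => rw [pow_succ, map_mul, mul_assoc, haπ, mul_smul_comm, ih, smul_smul, pow_succ']
  have hTz : ∀ g ∉ Subgroup.zpowers a, π * ρ g * π = 0 := by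
    intro g hg
    rcases hcase with h | ⟨rfl, h2n, -, κ, hκ, h⟩
    · exact absurd (h g) hg
    have h1 := h g⁻¹ (by simpa using hg)
    rw [inv_inv] at h1
    have h2 : ρ a * ρ g = ρ g * ρ (a ^ κ) := by
      rw [← map_mul, ← map_mul, ← h1]; congr 1; group
    have h3 : ζ • (π * ρ g * π) = ζ ^ κ • (π * ρ g * π) := by
      calc ζ • (π * ρ g * π) = π * (ρ a * ρ g) * π := by
            rw [← mul_assoc, hπa, smul_mul_assoc, smul_mul_assoc]
        _ = π * ρ g * (ρ (a ^ κ) * π) := by rw [h2]; simp only [mul_assoc]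
        _ = _ := by rw [hpow, mul_smul_comm]
    by_contra h0
    have h4 : ζ ^ 1 = ζ ^ κ := by rw [pow_one]; exact smul_left_injective ℂ h0 h3
    have h5 : (2 : ℕ) ^ 2 ≤ 2 ^ n := Nat.pow_le_pow_right two_pos h2n
    have h6 : (2 : ℕ) ^ (n - 1) ≤ 2 ^ n := Nat.pow_le_pow_right two_pos (by omega)
    have h7 := hprim.pow_inj (by omega) (by omega) h4
    rcases hκ with rfl | ⟨h3n, rfl⟩
    · omega
    · have h8 : (2 : ℕ) ^ 2 ≤ 2 ^ (n - 1) := Nat.pow_le_pow_right two_pos (by omega)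
      omega
  have hTπ : ∀ g ∈ Subgroup.zpowers a, π * ρ g = ρ g * π := by
    intro g hg
    obtain ⟨i, rfl⟩ := (mem_powers_iff_mem_zpowers (x := a)).2 hg
    have h1 : Commute π (ρ a) := hπa.trans haπ.symm
    simp only [map_pow]
    exact (h1.pow_right i).eq
  have htr := trace_proj_eq_one hρ hTz hππ haπ hπa hv.2 hπv
  have hΨ : ∀ i : ℕ, LinearMap.trace ℂ V (ρ (a ^ i) * π) = ζ ^ i := fun i ↦ by
    rw [hpow, map_smul, htr, smul_eq_mul, mul_one]
  have hform := hρ.card_mul_trace _ hTz hTπ hππ hπ0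
  have hcT : (Nat.card (Subgroup.zpowers a) : ℂ) = p ^ n := by
    rw [Nat.card_zpowers, ha]; push_cast; rfl
  have hpn' : (p ^ n : ℂ) ≠ 0 := by exact_mod_cast hpn
  rw [hcT] at hform
  have : NeZero (p ^ n) := ⟨hpn⟩
  rcases hcase with h | ⟨rfl, h2n, hc2, κ, hκ, hconj⟩
  · have hNn : N = n := by
      refine Nat.pow_right_injective hp.out.two_le ?_
      change p ^ N = p ^ n
      rw [← hcard, ← ha, ← Nat.card_zpowers, (Subgroup.eq_top_iff' _).2 h, Subgroup.card_top]
    subst hNn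
    have hχ : ∀ i : ℕ, LinearMap.trace ℂ V (ρ (a ^ i)) = ζ ^ i := fun i ↦ by
      have h1 : ∀ g, g⁻¹ * a ^ i * g = a ^ i := fun g ↦ by
        obtain ⟨j, rfl⟩ := h g
        simp only
        group
      have h2 := hform (a ^ i)
      simp only [h1, hΨ, Finset.sum_const, Finset.card_univ, nsmul_eq_mul] at h2
      rw [← Nat.card_eq_fintype_card, hcard, Nat.cast_pow] at h2
      exact mul_left_cancel₀ hpn' h2
    refine ⟨N, 0, fun h0 g ↦ ?_, Or.inl ⟨by simp, fun z hz ↦ ?_, fun k hk g ↦ ?_⟩⟩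
    · rw [h0, pow_zero] at hcard
      have := (Nat.card_eq_one_iff_unique.1 hcard).1
      rw [Subsingleton.elim g 1]
    · obtain ⟨i, -, rfl⟩ := hprim.eq_pow_of_pow_eq_one hz
      exact AddSubgroup.subset_closure ⟨a ^ i, by simpa using hχ i⟩
    · congr 2
      conv_rhs => rw [← pow_one g]
      rw [pow_eq_pow_iff_modEq]
      exact hk.of_dvd (hcard ▸ orderOf_dvd_natCard g)
  · have hNn : N = n + 1 := Nat.pow_right_injective le_rfl (hcard.symm.trans hc2)
    subst hNn
    have hκ2 := kappa_sq_modEq_one h2n hκ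
    have hχ : ∀ i : ℕ, LinearMap.trace ℂ V (ρ (a ^ i)) = ζ ^ i + ζ ^ (κ * i) := fun i ↦ by
      classical
      have h1 : ∀ g, LinearMap.trace ℂ V (ρ (g⁻¹ * a ^ i * g) * π) =
          if g ∈ Subgroup.zpowers a then ζ ^ i else ζ ^ (κ * i) := fun g ↦ by
        split_ifs with hg
        · have : g⁻¹ * a ^ i * g = a ^ i := by
            obtain ⟨j, rfl⟩ := hg
            simp only
            group
          rw [this, hΨ]
        · have h2 := hconj g⁻¹ (by simpa using hg)
          have h3 := conj_pow (i := i) (a := g⁻¹) (b := a)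
          rw [h2, ← pow_mul, inv_inv] at h3
          rw [← h3, hΨ]
      have h2 := hform (a ^ i)
      rw [Finset.sum_congr rfl fun g _ ↦ h1 g, Finset.sum_ite, Finset.sum_const,
        Finset.sum_const] at h2
      have h4 : (Finset.univ.filter (· ∈ Subgroup.zpowers a)).card = 2 ^ n := by
        rw [← Fintype.card_subtype, ← ha, ← Nat.card_zpowers, Nat.card_eq_fintype_card]
      have h5 := Finset.card_filter_add_card_filter_not (s := (Finset.univ : Finset P))
        (· ∈ Subgroup.zpowers a)
      rw [h4, Finset.card_univ, ← Nat.card_eq_fintype_card, hcard, pow_succ, mul_two] at h5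
      rw [h4, Nat.add_left_cancel h5, nsmul_eq_mul, nsmul_eq_mul, ← mul_add] at h2
      push_cast at h2 hpn'
      exact mul_left_cancel₀ hpn' h2
    have hχ0 : ∀ g ∉ Subgroup.zpowers a, LinearMap.trace ℂ V (ρ g) = 0 := fun g hg ↦ by
      have h2 := hform g
      rw [Finset.sum_eq_zero] at h2
      · exact (mul_eq_zero.1 h2).resolve_left hpn'
      · intro x _
        refine trace_mul_proj_eq_zero _ hTz hππ fun h ↦ hg ?_
        have := hA.conj_mem _ h x
        convert this using 1
        group
    have hmod : ∀ {s t : ℕ}, s ≡ t [MOD 2 ^ n] → ζ ^ s = ζ ^ t := fun h ↦ by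
      exact pow_eq_pow_of_modEq h hprim.pow_eq_one
    refine ⟨n, 0, by omega, Or.inr ⟨rfl, h2n, by omega, κ, hκ, fun z hz ↦ ?_, fun k hk g ↦ ?_⟩⟩
    · obtain ⟨i, -, rfl⟩ := hprim.eq_pow_of_pow_eq_one hz
      refine AddSubgroup.subset_closure ⟨a ^ i, ?_⟩
      simp only [hχ]
      ring
    · have hk2 : Nat.Coprime 2 k := by
        have h7 := odd_of_kappa h2n hκ
        rw [Nat.coprime_two_left, Nat.odd_iff]
        rw [Nat.odd_iff] at h7
        rcases hk with hk | hk <;>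
        · have := (hk.of_dvd (dvd_pow_self 2 (by omega)))
          unfold Nat.ModEq at this
          omega
      by_cases hg : g ∈ Subgroup.zpowers a
      · obtain ⟨i, rfl⟩ := (mem_powers_iff_mem_zpowers (x := a)).2 hg
        simp only [← pow_mul, hχ]
        rcases hk with hk | hk
        · rw [hmod (t := i) (by simpa using hk.mul_left i),
            hmod (s := κ * (i * k)) (t := κ * i) (by simpa using (hk.mul_left i).mul_left κ)]
        · rw [add_comm, hmod (s := i * k) (t := κ * i) (by simpa [mul_comm] using hk.mul_left i),
            hmod (s := κ * (i * k)) (t := i)]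
          have h1 : κ * (i * k) ≡ κ * (i * κ) [MOD 2 ^ n] := (hk.mul_left i).mul_left κ
          refine h1.trans ?_
          rw [mul_left_comm]
          simpa using hκ2.mul_left i
      · simp only
        rw [hχ0 g hg, hχ0 _ fun h ↦ hg (mem_of_pow_mem_of_coprime hcard hk2 h)]

theorem rowProperty_of_isSchur {p : ℕ} [hp : Fact p.Prime] (N : ℕ) :
    ∀ (P V : Type) [Group P] [Finite P] [AddCommGroup V] [Module ℂ V] [FiniteDimensional ℂ V]
      (ρ : P →* Module.End ℂ V), Nat.card P = p ^ N → IsSchur ρ →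
        RowProperty p N fun g ↦ LinearMap.trace ℂ V (ρ g) := by
  induction N using Nat.strong_induction_on with
  | _ N ih =>
    intro P V _ _ _ _ _ ρ hcard hρ
    by_cases hinj : Function.Injective ρ
    · by_cases hT : HasTwist p P
      · exact rowProperty_of_hasTwist hρ hinj hT hcard fun N' hN' Q W _ _ _ _ _ σ ↦
          ih N' hN' Q W σ
      · exact rowProperty_of_not_hasTwist hρ hinj hT hcard
    · have hcq := Subgroup.card_eq_card_quotient_mul_card_subgroup ρ.ker
      rw [hcard] at hcq
      obtain ⟨N', hN', hQ⟩ := (Nat.dvd_prime_pow hp.out).1 (Dvd.intro _ hcq.symm)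
      have hlt : N' < N := by
        refine lt_of_le_of_ne hN' ?_
        rintro rfl
        rw [hQ] at hcq
        have h1 : Nat.card ρ.ker = 1 :=
          (Nat.mul_left_cancel (pow_pos hp.out.pos _) ((mul_one _).trans hcq)).symm
        exact hinj ((MonoidHom.ker_eq_bot_iff ρ).1 (Subgroup.card_eq_one.1 h1))
      set π := QuotientGroup.mk' ρ.ker with hπ
      obtain ⟨σ, hσ⟩ : ∃ σ : P ⧸ ρ.ker →* Module.End ℂ V, σ.comp π = ρ :=
        ⟨QuotientGroup.lift ρ.ker ρ fun x hx ↦ hx, MonoidHom.ext fun g ↦ rfl⟩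
      have h1 := (ih N' hlt (P ⧸ ρ.ker) V σ hQ (IsSchur.of_comp (hσ ▸ hρ))).comp hN' π
        (QuotientGroup.mk'_surjective _)
      rw [← hσ]
      exact h1

end Row

section Characters

variable {G : Type} [Group G]

/-- The endomorphism of an object of `FDRep ℂ G` given by an equivariant linear map. -/
def FDRep.endOfCommute (V : FDRep ℂ G) (f : Module.End ℂ V) (hf : ∀ g, f * V.ρ g = V.ρ g * f) :
    V ⟶ V :=
  ⟨InducedCategory.homMk (ModuleCat.ofHom f), fun g ↦ by
    ext1
    simp only [FGModuleCat.obj_carrier]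
    exact hf g⟩

theorem FDRep.commute_hom (V : FDRep ℂ G) (f : V ⟶ V) (g : G) :
    (f.hom.hom.hom : Module.End ℂ V) * V.ρ g = V.ρ g * f.hom.hom.hom :=
  LinearMap.ext fun x ↦
    ConcreteCategory.congr_hom ((forget (FGModuleCat ℂ)).congr_map (f.comm g)) x

theorem IsSchur.simple [Finite G] {V : Type} [AddCommGroup V] [Module ℂ V] [FiniteDimensional ℂ V]
    {ρ : G →* Module.End ℂ V} (hρ : IsSchur ρ) : Simple (FDRep.of ρ) := by
  have : NeZero (Nat.card G : ℂ) := ⟨Nat.cast_ne_zero.2 Nat.card_pos.ne'⟩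
  have := hρ.1
  rw [FDRep.simple_iff_end_is_rank_one]
  refine finrank_eq_one (𝟙 (FDRep.of ρ)) ?_ fun f ↦ ?_
  · intro h
    have h1 : (1 : Module.End ℂ V) = 0 :=
      congr_arg (fun f : FDRep.of ρ ⟶ FDRep.of ρ ↦ (f.hom.hom.hom : Module.End ℂ V)) h
    exact one_ne_zero h1
  · obtain ⟨c, hc⟩ := hρ.2 f.hom.hom.hom fun g ↦ (FDRep.of ρ).commute_hom f g
    refine ⟨c, ?_⟩
    apply Action.Hom.ext
    apply InducedCategory.hom_ext
    exact ModuleCat.hom_ext hc.symm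

theorem isSchur_of_simple (V : FDRep ℂ G) [Simple V] : IsSchur V.ρ := by
  have h1 := finrank_endomorphism_simple_eq_one ℂ V
  refine ⟨?_, fun f hf ↦ ?_⟩
  · by_contra hV
    rw [not_nontrivial_iff_subsingleton] at hV
    refine id_nonzero V ?_
    apply Action.Hom.ext
    apply InducedCategory.hom_ext
    exact ModuleCat.hom_ext (LinearMap.ext fun x : V ↦ Subsingleton.elim _ _)
  · obtain ⟨c, hc⟩ := (finrank_eq_one_iff_of_nonzero' (𝟙 V) (id_nonzero V)).1 h1
      (V.endOfCommute f hf)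
    exact ⟨c, (congr_arg (fun f : V ⟶ V ↦ (f.hom.hom.hom : Module.End ℂ V)) hc).symm⟩

theorem IsSchur.sum_conj_eq_smul [Fintype G] {V : Type} [AddCommGroup V] [Module ℂ V]
    [FiniteDimensional ℂ V] {ρ : G →* Module.End ℂ V} (hρ : IsSchur ρ) (g : G) :
    ∑ s, ρ (s * g * s⁻¹) =
      ((Fintype.card G : ℂ) * LinearMap.trace ℂ V (ρ g) / Module.finrank ℂ V) • 1 := by
  have := hρ.1
  obtain ⟨c, hc⟩ := hρ.2 (∑ s, ρ (s * g * s⁻¹)) fun h ↦ by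
    rw [Finset.sum_mul, Finset.mul_sum]
    refine Fintype.sum_equiv (Equiv.mulLeft h⁻¹) _ _ fun s ↦ ?_
    rw [← map_mul, ← map_mul]
    congr 1
    simp [mul_assoc]
  have h1 := congr_arg (LinearMap.trace ℂ V) hc
  have h2 (s : G) : LinearMap.trace ℂ V (ρ (s * g * s⁻¹)) = LinearMap.trace ℂ V (ρ g) := by
    rw [map_mul, LinearMap.trace_mul_comm, ← map_mul]
    congr 2
    group
  rw [map_sum, Finset.sum_congr rfl fun s _ ↦ h2 s, map_smul, LinearMap.trace_one] at h1
  rw [hc]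
  congr 1
  rw [eq_div_iff (Nat.cast_ne_zero.2 Module.finrank_pos.ne')]
  simpa [eq_comm] using h1

theorem isConj_of_character_eq [Finite G] {g h : G}
    (H : ∀ (V : FDRep ℂ G), Simple V → V.character g = V.character h) : IsConj g h := by
  classical
  have := Fintype.ofFinite G
  set x : MonoidAlgebra ℂ G := ∑ s, (MonoidAlgebra.of ℂ G (s * g * s⁻¹) -
    MonoidAlgebra.of ℂ G (s * h * s⁻¹)) with hx
  have hker (S : Submodule (MonoidAlgebra ℂ G) (MonoidAlgebra ℂ G))
      [IsSimpleModule (MonoidAlgebra ℂ G) S] (y : S) : x • y = 0 := by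
    have hfin : FiniteDimensional ℂ S := inferInstanceAs (FiniteDimensional ℂ (S.restrictScalars ℂ))
    set L := (Algebra.lsmul ℂ ℂ S : MonoidAlgebra ℂ G →ₐ[ℂ] Module.End ℂ S) with hL
    set ρ : G →* Module.End ℂ S := L.toMonoidHom.comp (MonoidAlgebra.of ℂ G) with hρ
    have hS : IsSchur ρ := by
      refine ⟨IsSimpleModule.nontrivial (MonoidAlgebra ℂ G) S, fun f hf ↦ ?_⟩
      obtain ⟨c, hc⟩ := (IsSimpleModule.algebraMap_end_bijective_of_isAlgClosed ℂ
        (A := MonoidAlgebra ℂ G) (V := S)).2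
        (MonoidAlgebra.equivariantOfLinearOfComm f fun g v ↦ LinearMap.congr_fun (hf g) v)
      exact ⟨c, LinearMap.ext fun v ↦ (LinearMap.congr_fun hc v).symm⟩
    have h1 : LinearMap.trace ℂ S (ρ g) = LinearMap.trace ℂ S (ρ h) := H (FDRep.of ρ) hS.simple
    have h2 : L x = 0 := by
      rw [hx, map_sum]
      simp only [map_sub, Finset.sum_sub_distrib]
      exact sub_eq_zero.2 ((hS.sum_conj_eq_smul g).trans (h1 ▸ (hS.sum_conj_eq_smul h).symm))
    exact LinearMap.congr_fun h2 y
  have hx0 : x = 0 := by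
    have h1 : (1 : MonoidAlgebra ℂ G) ∈ sSup {S : Submodule (MonoidAlgebra ℂ G)
        (MonoidAlgebra ℂ G) | IsSimpleModule (MonoidAlgebra ℂ G) S} := by
      have : NeZero (Nat.card G : ℂ) := ⟨Nat.cast_ne_zero.2 Nat.card_pos.ne'⟩
      rw [IsSemisimpleModule.sSup_simples_eq_top]
      exact Submodule.mem_top
    rw [sSup_eq_iSup'] at h1
    have h2 : x * 1 = 0 := Submodule.iSup_induction _ (motive := fun y ↦ x * y = 0) h1
      (fun S y hy ↦ by
        have := S.2.out
        exact congr_arg Subtype.val (hker S.1 ⟨y, hy⟩))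
      (mul_zero x) fun a b ha hb ↦ by rw [mul_add, ha, hb, add_zero]
    rwa [mul_one] at h2
  by_contra hgh
  have h1 := congr_arg (fun y : MonoidAlgebra ℂ G ↦ y.coeff g) hx0
  have h2 (s : G) : s * h * s⁻¹ ≠ g := fun h ↦ hgh (isConj_iff.2 ⟨s, h⟩).symm
  simp only [hx, MonoidAlgebra.of_apply, Finset.sum_sub_distrib, MonoidAlgebra.coeff_sub,
    MonoidAlgebra.coeff_sum, MonoidAlgebra.coeff_single, Finsupp.coe_sub, Finsupp.coe_finsetSum,
    Pi.sub_apply, Finset.sum_apply, Finsupp.single_apply, h2, if_false, Finset.sum_const_zero,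
    sub_zero, Finset.sum_boole, MonoidAlgebra.coeff_zero, Finsupp.coe_zero, Pi.zero_apply,
    Nat.cast_eq_zero, Finset.card_eq_zero] at h1
  exact Finset.notMem_empty (1 : G) (by rw [← h1]; simp)
end Characters

section Averages

theorem sum_pow_one_add_mul {z : ℂ} {q L : ℕ} (h : z ^ (q * L) = 1) :
    ∑ i : Fin L, z ^ (1 + q * i) = if z ^ q = 1 then (L : ℂ) * z else 0 := by
  simp only [pow_add, pow_one, pow_mul, ← Finset.mul_sum]
  rw [Fin.sum_univ_eq_sum_range (fun i ↦ (z ^ q) ^ i)]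
  split_ifs with hz
  · simp [hz, mul_comm]
  · rw [geom_sum_eq hz, ← pow_mul, h, sub_self, zero_div, mul_zero]

theorem four_dvd_kappa_add_one {n κ : ℕ} (hn : 2 ≤ n)
    (h : κ = 2 ^ n - 1 ∨ 3 ≤ n ∧ κ = 2 ^ (n - 1) - 1) : 4 ∣ κ + 1 := by
  have key : ∀ m : ℕ, 2 ≤ m → 4 ∣ 2 ^ m - 1 + 1 := fun m hm ↦ by
    rw [Nat.sub_add_cancel Nat.one_le_two_pow]
    exact pow_dvd_pow 2 hm
  rcases h with rfl | ⟨h3, rfl⟩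
  · exact key n hn
  · exact key (n - 1) (by omega)

theorem IsPrimitiveRoot.pow_two_pow_sub_one {w : ℂ} {n : ℕ} (hw : IsPrimitiveRoot w (2 ^ n))
    (hn : n ≠ 0) : w ^ 2 ^ (n - 1) = -1 := by
  have h1 : (w ^ 2 ^ (n - 1)) ^ 2 = 1 := by
    rw [← pow_mul, ← pow_succ, Nat.sub_add_cancel (by omega), hw.pow_eq_one]
  have h2 : w ^ 2 ^ (n - 1) ≠ 1 := fun h ↦ by
    have := (Nat.pow_dvd_pow_iff_le_right (by norm_num)).1 (hw.dvd_of_pow_eq_one _ h)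
    omega
  exact (mul_self_eq_one_iff.1 ((pow_two _).symm.trans h1)).resolve_left h2

theorem two_pow_mul_mem_of_sub_mem {R : Subring ℂ} {m n j j' κ : ℕ} {w : ℂ} (hn : 2 ≤ n)
    (hnm : n ≤ m) (hκ : κ = 2 ^ m - 1 ∨ 3 ≤ m ∧ κ = 2 ^ (m - 1) - 1)
    (hw : IsPrimitiveRoot w (2 ^ n)) (hwR : 2 ^ j' * (w - w ^ κ) ∈ R)
    (hR : ∀ z : ℂ, z ^ 2 ^ m = 1 → 2 ^ j * (z + z ^ κ) ∈ R) {z : ℂ} (hz : z ^ 2 ^ m = 1) :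
    2 ^ (j + j' + 2) * z ∈ R := by
  have hκo := odd_of_kappa (hn.trans hnm) hκ
  have hκ2 := kappa_sq_modEq_one (hn.trans hnm) hκ
  have hw0 : w ≠ 0 := hw.ne_zero (by positivity)
  have hwm : w ^ 2 ^ m = 1 := (hw.pow_eq_one_iff_dvd _).2 (pow_dvd_pow 2 hnm)
  have hwκ : (w ^ κ) ^ κ = w := by
    rw [← pow_mul, ← pow_mod_orderOf, hκ2.of_dvd (orderOf_dvd_of_pow_eq_one hwm),
      pow_mod_orderOf, pow_one]
  set q := w / w ^ κ with hq
  have hqm : q ^ 2 ^ m = 1 := by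
    rw [hq, div_pow, ← pow_mul, mul_comm κ, pow_mul, hwm, one_pow, div_one]
  have hqL : q ^ 2 ^ (n - 2) = -1 := by
    obtain ⟨t, ht⟩ := four_dvd_kappa_add_one (hn.trans hnm) hκ
    have h3 : q = w ^ 2 / w ^ (κ + 1) := by rw [hq, pow_succ w κ, pow_two]; field_simp
    have h4 : 4 * t * 2 ^ (n - 2) = 2 ^ n * t := by
      obtain ⟨n, rfl⟩ := Nat.exists_eq_add_of_le' hn
      rw [Nat.add_sub_cancel, pow_add]; ring
    rw [h3, ht, div_pow, ← pow_mul, ← pow_mul, ← pow_succ', h4, pow_mul, hw.pow_eq_one, one_pow,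
      div_one, show n - 2 + 1 = n - 1 by omega]
    exact hw.pow_two_pow_sub_one (by omega)
  have step (i : ℕ) : 2 ^ (j + j') * ((z * q ^ (i + 1) - (z * q ^ (i + 1)) ^ κ) -
      (z * q ^ i - (z * q ^ i) ^ κ)) ∈ R := by
    have h1 := R.mul_mem hwR (hR (z * q ^ i / w ^ κ) (by
      rw [div_pow, mul_pow, hz, ← pow_mul, ← pow_mul, mul_comm i, mul_comm κ, pow_mul, pow_mul,
        hqm, hwm]
      simp))
    convert h1 using 1
    have h2 : z * q ^ (i + 1) = w * (z * q ^ i / w ^ κ) := by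
      rw [pow_succ, hq]; ring
    have h3 : z * q ^ i = w ^ κ * (z * q ^ i / w ^ κ) := by
      field_simp
    rw [h2]
    nth_rw 3 [h3]
    nth_rw 4 [h3]
    generalize z * q ^ i / w ^ κ = u
    rw [mul_pow, mul_pow, hwκ]
    ring
  have hsum := R.sum_mem (t := Finset.range (2 ^ (n - 2))) fun i _ ↦ step i
  rw [← Finset.mul_sum, Finset.sum_range_sub (fun i ↦ z * q ^ i - (z * q ^ i) ^ κ), hqL, pow_zero,
    mul_one, mul_neg_one, hκo.neg_pow] at hsum
  have h4 := R.sub_mem (R.mul_mem (R.pow_mem (x := 2) (ofNat_mem R 2) (j' + 1))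
    (hR z hz)) hsum
  convert h4 using 1
  ring

/-- Some exponents fixing every conjugacy class of `G` are such that averaging a root of unity over
them and multiplying by a proper divisor of `|G|` gives an element of `ℤ[G]`. -/
def AverageProperty (G : Type) [Group G] : Prop :=
  ∃ (E : ℕ) (ι : Type) (_ : Fintype ι) (_ : Nonempty ι) (k : ι → ℕ),
    (∀ i, (k i).Coprime (Nat.card G)) ∧ (∀ i (g : G), IsConj g (g ^ k i)) ∧ E ∣ Nat.card G ∧
    (Nontrivial G → E ≠ Nat.card G) ∧
    ∀ z : ℂ, z ^ Nat.card G = 1 → E * ((Fintype.card ι : ℂ)⁻¹ * ∑ i, z ^ k i) ∈ charRing G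

theorem valueSpan_character_le {G : Type} [Group G] (V : FDRep ℂ G) (hV : Simple V) {z : ℂ}
    (hz : z ∈ valueSpan V.character) : z ∈ charRing G := by
  refine (AddSubgroup.closure_le (charRing G).toAddSubgroup).2 ?_ hz
  rintro _ ⟨g, rfl⟩
  exact Subring.subset_closure ⟨V, hV, g, rfl⟩

theorem coprime_one_add_pow_mul (p N i : ℕ) {m : ℕ} (hm : m ≠ 0) :
    (1 + p ^ m * i).Coprime (p ^ N) := by
  refine Nat.Coprime.pow_right _ ?_
  obtain ⟨m, rfl⟩ := Nat.exists_eq_succ_of_ne_zero hm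
  rw [Nat.succ_eq_add_one, pow_succ', mul_assoc]
  simp

theorem averageProperty_of_conj_of_mem {P : Type} [Group P] {p N m e : ℕ} [hp : Fact p.Prime]
    (hcard : Nat.card P = p ^ N) (hm : m ≠ 0) (hmN : m ≤ N) (he : e < N)
    (hconj : ∀ k, k ≡ 1 [MOD p ^ m] → ∀ g : P, IsConj g (g ^ k))
    (hmem : ∀ z : ℂ, z ^ p ^ m = 1 → p ^ e * z ∈ charRing P) : AverageProperty P := by
  have hL : p ^ (N - m) ≠ 0 := pow_ne_zero _ hp.out.ne_zero
  refine ⟨p ^ e, Fin (p ^ (N - m)), inferInstance, Fin.pos_iff_nonempty.1 (Nat.pos_of_ne_zero hL),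
    fun i ↦ 1 + p ^ m * i, fun i ↦ ?_, fun i ↦ hconj _ (by simp [Nat.ModEq]), ?_, fun _ ↦ ?_,
    fun z hz ↦ ?_⟩
  · rw [hcard]
    exact coprime_one_add_pow_mul p N i hm
  · rw [hcard]
    exact pow_dvd_pow p he.le
  · rw [hcard]
    exact (Nat.pow_lt_pow_right hp.out.one_lt he).ne
  · rw [hcard] at hz
    rw [sum_pow_one_add_mul (by rwa [← pow_add, Nat.add_sub_cancel' hmN]), Fintype.card_fin]
    split_ifs with h
    · rw [inv_mul_cancel_left₀ (Nat.cast_ne_zero.2 hL)]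
      exact_mod_cast hmem z h
    · simp [(charRing P).zero_mem]

theorem averageProperty_of_conj_of_add_mem {P : Type} [Group P] {N m j κ : ℕ}
    (hcard : Nat.card P = 2 ^ N) (hm : m ≠ 0) (hmN : m ≤ N) (he : j + 1 < N) (hκ : Odd κ)
    (hconj : ∀ k, k ≡ 1 [MOD 2 ^ m] ∨ k ≡ κ [MOD 2 ^ m] → ∀ g : P, IsConj g (g ^ k))
    (hmem : ∀ z : ℂ, z ^ 2 ^ m = 1 → 2 ^ j * (z + z ^ κ) ∈ charRing P) : AverageProperty P := by
  have hL : 2 ^ (N - m) ≠ 0 := by positivity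
  refine ⟨2 ^ (j + 1), Fin (2 ^ (N - m)) ⊕ Fin (2 ^ (N - m)), inferInstance,
    ⟨Sum.inl ⟨0, Nat.pos_of_ne_zero hL⟩⟩,
    Sum.elim (fun i ↦ 1 + 2 ^ m * i) (fun i ↦ κ * (1 + 2 ^ m * i)), ?_, ?_, ?_, fun _ ↦ ?_,
    fun z hz ↦ ?_⟩
  · rw [hcard]
    rintro (i | i)
    · exact coprime_one_add_pow_mul 2 N i hm
    · exact Nat.Coprime.mul_left ((Nat.coprime_two_right.2 hκ).pow_right _)
        (coprime_one_add_pow_mul 2 N i hm)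
  · rintro (i | i)
    · exact hconj _ (Or.inl (by simp [Nat.ModEq]))
    · exact hconj _ (Or.inr (by
        simpa using (show 1 + 2 ^ m * (i : ℕ) ≡ 1 [MOD 2 ^ m] by simp [Nat.ModEq]).mul_left κ))
  · rw [hcard]
    exact pow_dvd_pow 2 he.le
  · rw [hcard]
    exact (Nat.pow_lt_pow_right one_lt_two he).ne
  · rw [hcard] at hz
    have hz' : z ^ (2 ^ m * 2 ^ (N - m)) = 1 := by rwa [← pow_add, Nat.add_sub_cancel' hmN]
    simp only [Fintype.sum_sum_type, Sum.elim_inl, Sum.elim_inr, pow_mul z κ]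
    rw [sum_pow_one_add_mul hz', sum_pow_one_add_mul (by rw [← pow_mul, mul_comm, pow_mul, hz',
      one_pow]), Fintype.card_sum, Fintype.card_fin]
    have h1 : (z ^ κ) ^ 2 ^ m = 1 ↔ z ^ 2 ^ m = 1 := by
      rw [← pow_mul, mul_comm, pow_mul]
      refine ⟨fun h ↦ ?_, fun h ↦ by rw [h, one_pow]⟩
      have h2 : orderOf (z ^ 2 ^ m) ∣ 2 ^ (N - m) := by
        rwa [orderOf_dvd_iff_pow_eq_one, ← pow_mul]
      exact orderOf_eq_one_iff.1 (Nat.Coprime.eq_one_of_dvd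
        (Nat.Coprime.coprime_dvd_left h2 ((Nat.coprime_two_left.2 hκ).pow_left _))
        (orderOf_dvd_of_pow_eq_one h))
    simp only [h1]
    split_ifs with h
    · convert hmem z h using 1
      have h3 : ((2 ^ (N - m) : ℕ) : ℂ) ≠ 0 := Nat.cast_ne_zero.2 hL
      push_cast at h3 ⊢
      field_simp
      ring
    · simp [(charRing P).zero_mem]

theorem kappa_modEq_add {m n κ κ' : ℕ} (hn : 2 ≤ n) (hnm : n ≤ m)
    (hκ : κ = 2 ^ m - 1 ∨ 3 ≤ m ∧ κ = 2 ^ (m - 1) - 1)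
    (hκ' : κ' = 2 ^ n - 1 ∨ 3 ≤ n ∧ κ' = 2 ^ (n - 1) - 1) (h : ¬ κ ≡ κ' [MOD 2 ^ n]) :
    κ ≡ κ' + 2 ^ (n - 1) [MOD 2 ^ n] := by
  have h2 : 2 ^ n = 2 ^ (n - 1) + 2 ^ (n - 1) := by
    rw [← two_mul, ← pow_succ', Nat.sub_add_cancel (by omega)]
  have hpos : 0 < 2 ^ (n - 1) := by positivity
  have key (l : ℕ) (hl : n ≤ l) : 2 ^ l - 1 ≡ 2 ^ n - 1 [MOD 2 ^ n] := by
    refine Nat.ModEq.add_right_cancel' 1 ?_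
    rw [Nat.sub_add_cancel Nat.one_le_two_pow, Nat.sub_add_cancel Nat.one_le_two_pow]
    exact ((Nat.modEq_zero_iff_dvd.2 (pow_dvd_pow 2 hl))).trans (by simp [Nat.ModEq])
  have key' (hk : κ ≡ 2 ^ n - 1 [MOD 2 ^ n]) : κ ≡ κ' + 2 ^ (n - 1) [MOD 2 ^ n] := by
    rcases hκ' with rfl | ⟨-, rfl⟩
    · exact absurd hk h
    · rwa [show 2 ^ (n - 1) - 1 + 2 ^ (n - 1) = 2 ^ n - 1 by omega]
  rcases hκ with rfl | ⟨-, rfl⟩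
  · exact key' (key m hnm)
  · rcases hnm.lt_or_eq with hlt | rfl
    · exact key' (key _ (by omega))
    · rcases hκ' with rfl | ⟨-, rfl⟩
      · rw [show 2 ^ n - 1 + 2 ^ (n - 1) = 2 ^ (n - 1) - 1 + 2 ^ n by omega]
        simp [Nat.ModEq]
      · exact absurd rfl h

theorem averageProperty_of_isPGroup {P : Type} [Group P] [Finite P] [Nontrivial P] {p N : ℕ}
    [hp : Fact p.Prime] (hcard : Nat.card P = p ^ N) : AverageProperty P := by
  have hrow (V : FDRep ℂ P) (hV : Simple V) : RowProperty p N V.character :=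
    rowProperty_of_isSchur N P V V.ρ hcard (isSchur_of_simple V)
  choose n j h0 hrow using hrow
  set S : Set ℕ := {a | ∃ V hV, n V hV = a} with hS
  have hle (V : FDRep ℂ P) (hV : Simple V) : n V hV ≤ N := by
    rcases hrow V hV with ⟨h, -⟩ | ⟨-, -, h, -⟩ <;> omega
  have hbdd : BddAbove S := ⟨N, by rintro _ ⟨V, hV, rfl⟩; exact hle V hV⟩
  obtain ⟨V₁, hV₁, h1⟩ : ∃ V hV, n V hV ≠ 0 := by
    by_contra! H
    obtain ⟨g, hg⟩ := exists_ne (1 : P)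
    exact hg (isConj_one_left.1 (isConj_of_character_eq fun V hV ↦ (h0 V hV (H V hV) g)))
  obtain ⟨V, hV, hVm⟩ : sSup S ∈ S := Nat.sSup_mem ⟨_, V₁, hV₁, rfl⟩ hbdd
  have hmax (V' : FDRep ℂ P) (hV' : Simple V') : n V' hV' ≤ n V hV :=
    hVm ▸ le_csSup hbdd ⟨V', hV', rfl⟩
  have hm : n V hV ≠ 0 := (Nat.pos_of_ne_zero h1 |>.trans_le (hmax V₁ hV₁)).ne'
  have hconj (k : ℕ) (hk : k ≡ 1 [MOD p ^ n V hV]) (g : P) : IsConj g (g ^ k) := by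
    refine isConj_of_character_eq fun V' hV' ↦ ?_
    have hk' : k ≡ 1 [MOD p ^ n V' hV'] := hk.of_dvd (pow_dvd_pow p (hmax V' hV'))
    rcases hrow V' hV' with ⟨-, -, h⟩ | ⟨hp2, -, -, κ, -, -, h⟩
    · exact (h k hk' g).symm
    · refine (h k (Or.inl ?_) g).symm
      rwa [hp2] at hk'
  rcases hrow V hV with ⟨h1, h2, -⟩ | ⟨rfl, h1, h2, κ, hκ, h3, h4⟩
  · exact averageProperty_of_conj_of_mem (e := j V hV) hcard hm (hle V hV) (by omega) hconj
      fun z hz ↦ valueSpan_character_le V hV (h2 z hz)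
  have hκo := odd_of_kappa h1 hκ
  replace h3 (z : ℂ) (hz : z ^ 2 ^ n V hV = 1) := valueSpan_character_le V hV (h3 z hz)
  by_cases hstable : ∀ k, k ≡ κ [MOD 2 ^ n V hV] → ∀ g : P, IsConj g (g ^ k)
  · exact averageProperty_of_conj_of_add_mem hcard hm (hle V hV) (by omega) hκo
      (fun k hk ↦ hk.elim (hconj k) (hstable k)) h3
  push Not at hstable
  obtain ⟨k, hk, g, hg⟩ := hstable
  obtain ⟨V', hV', hg⟩ : ∃ V' : FDRep ℂ P, Simple V' ∧ V'.character g ≠ V'.character (g ^ k) := by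
    by_contra! H
    exact hg (isConj_of_character_eq H)
  have hn' := hmax V' hV'
  obtain ⟨hn2, hj', w, hw, hwR⟩ : 2 ≤ n V' hV' ∧ 2 * j V' hV' + n V' hV' ≤ N ∧ ∃ w : ℂ,
      IsPrimitiveRoot w (2 ^ n V' hV') ∧ 2 ^ j V' hV' * (w - w ^ κ) ∈ charRing P := by
    obtain ⟨w, hw⟩ : ∃ w : ℂ, IsPrimitiveRoot w (2 ^ n V' hV') :=
      ⟨_, Complex.isPrimitiveRoot_exp _ (by positivity)⟩
    have hk' : k ≡ κ [MOD 2 ^ n V' hV'] := hk.of_dvd (pow_dvd_pow 2 hn')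
    rcases hrow V' hV' with ⟨h5, h6, h7⟩ | ⟨-, h5, h6, κ', hκ', h7, h8⟩
    · refine ⟨?_, h5, _, hw, ?_⟩
      · by_contra! hlt
        refine hg (h7 k (hk'.trans ?_) g).symm
        have h9 : κ ≡ 1 [MOD 2 ^ 1] := Nat.odd_iff.1 hκo
        exact h9.of_dvd (pow_dvd_pow 2 (by omega))
      · rw [mul_sub]
        refine sub_mem (valueSpan_character_le V' hV' (by simpa using h6 _ hw.pow_eq_one))
          (valueSpan_character_le V' hV' ?_)
        simpa using h6 (w ^ κ) (by rw [← pow_mul, mul_comm, pow_mul, hw.pow_eq_one, one_pow])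
    · refine ⟨h5, by omega, _, hw, ?_⟩
      have h9 := kappa_modEq_add h5 hn' hκ hκ' fun h ↦ hg (h8 k (Or.inr (hk'.trans h)) g).symm
      have h10 := valueSpan_character_le V' hV' (h7 _ hw.pow_eq_one)
      have h11 : w ^ κ = w ^ (κ' + 2 ^ (n V' hV' - 1)) := by
        rw [← pow_mod_orderOf, ← pow_mod_orderOf w (κ' + _), ← hw.eq_orderOf]
        exact congr_arg _ h9
      rwa [h11, pow_add, hw.pow_two_pow_sub_one (by omega), mul_neg_one, sub_neg_eq_add]
  refine averageProperty_of_conj_of_mem (e := j V hV + j V' hV' + 2) hcard hm (hle V hV) (by omega)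
    hconj fun z hz ↦ ?_
  exact_mod_cast two_pow_mul_mem_of_sub_mem hn2 hn' hκ hw hwR h3 hz

end Averages

section Products

variable {G H : Type} [Group G] [Group H]

theorem charRing_le_of_surjective [Finite H] (f : H →* G) (hf : Function.Surjective f) :
    charRing G ≤ charRing H := by
  refine Subring.closure_le.2 ?_
  rintro _ ⟨V, hV, g, rfl⟩
  obtain ⟨h, rfl⟩ := hf g
  have h1 := isSchur_of_simple V
  have h2 : IsSchur (V.ρ.comp f) := ⟨h1.1, fun x hx ↦ h1.2 x fun g ↦ by
    obtain ⟨h, rfl⟩ := hf g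
    exact hx h⟩
  exact Subring.subset_closure ⟨FDRep.of (V.ρ.comp f), h2.simple, h, rfl⟩

theorem averageProperty_of_subsingleton [Subsingleton G] : AverageProperty G := by
  refine ⟨1, Unit, inferInstance, inferInstance, fun _ ↦ 1, by simp, fun _ g ↦ ?_, by simp,
    fun h ↦ absurd h (not_nontrivial G), fun z hz ↦ ?_⟩
  · rw [pow_one]
  · rw [Nat.card_unique, pow_one] at hz
    simp [hz, (charRing G).one_mem]

theorem AverageProperty.congr [Finite H] (h : AverageProperty G) (e : G ≃* H) :
    AverageProperty H := by
  obtain ⟨E, ι, _, _, k, h1, h2, h3, h4, h5⟩ := h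
  rw [Nat.card_congr e.toEquiv] at *
  refine ⟨E, ι, _, ‹_›, k, h1, fun i g ↦ ?_, h3, fun h ↦ h4 e.toEquiv.nontrivial, fun z hz ↦
    charRing_le_of_surjective e.symm.toMonoidHom e.symm.surjective (h5 z hz)⟩
  simpa using e.toMonoidHom.map_isConj (h2 i (e.symm g))

theorem AverageProperty.prod [Finite G] [Finite H] (hG : AverageProperty G)
    (hH : AverageProperty H) (hcop : (Nat.card G).Coprime (Nat.card H)) :
    AverageProperty (G × H) := by
  obtain ⟨E, ι, _, _, k, h1, h2, h3, h4, h5⟩ := hG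
  obtain ⟨E', ι', _, _, k', h1', h2', h3', h4', h5'⟩ := hH
  set K : ι × ι' → ℕ := fun i ↦ Nat.chineseRemainder hcop (k i.1) (k' i.2) with hK
  have hK1 (i : ι × ι') : K i ≡ k i.1 [MOD Nat.card G] := (Nat.chineseRemainder hcop _ _).2.1
  have hK2 (i : ι × ι') : K i ≡ k' i.2 [MOD Nat.card H] := (Nat.chineseRemainder hcop _ _).2.2
  have hpow {M : Type} [Monoid M] {x : M} {n a b : ℕ} (hx : x ^ n = 1) (hab : a ≡ b [MOD n]) :
      x ^ a = x ^ b := by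
    rw [← pow_mod_orderOf, ← pow_mod_orderOf x b, hab.of_dvd (orderOf_dvd_of_pow_eq_one hx)]
  refine ⟨E * E', ι × ι', inferInstance, inferInstance, K, fun i ↦ ?_, fun i g ↦ ?_, ?_, ?_, ?_⟩
  · rw [Nat.card_prod]
    exact Nat.Coprime.mul_right ((hK1 i).gcd_eq.trans (h1 i.1)) ((hK2 i).gcd_eq.trans (h1' i.2))
  · obtain ⟨c, hc⟩ := isConj_iff.1 (h2 i.1 g.1)
    obtain ⟨c', hc'⟩ := isConj_iff.1 (h2' i.2 g.2)
    refine isConj_iff.2 ⟨(c, c'), Prod.ext ?_ ?_⟩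
    · exact hc.trans (hpow (pow_card_eq_one') (hK1 i)).symm
    · exact hc'.trans (hpow (pow_card_eq_one') (hK2 i)).symm
  · rw [Nat.card_prod]
    exact mul_dvd_mul h3 h3'
  · intro hnt heq
    rw [Nat.card_prod] at heq
    have hE : E = Nat.card G := by
      refine le_antisymm (Nat.le_of_dvd Nat.card_pos h3) ?_
      by_contra! hlt
      exact (Nat.mul_lt_mul_of_lt_of_le hlt (Nat.le_of_dvd Nat.card_pos h3') Nat.card_pos).ne heq
    have hE' : E' = Nat.card H := by
      rw [hE] at heq
      exact Nat.eq_of_mul_eq_mul_left Nat.card_pos heq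
    rcases subsingleton_or_nontrivial G with _ | hG
    · rcases subsingleton_or_nontrivial H with _ | hH
      · exact not_nontrivial (G × H) hnt
      · exact h4' hH hE'
    · exact h4 hG hE
  · intro z hz
    rw [Nat.card_prod] at hz
    obtain ⟨u, hu1, hu2⟩ := Nat.chineseRemainder hcop 1 0
    obtain ⟨v, hv1, hv2⟩ := Nat.chineseRemainder hcop 0 1
    have huv : z = z ^ u * z ^ v := by
      rw [← pow_add]
      conv_lhs => rw [← pow_one z]
      refine hpow hz ((Nat.modEq_and_modEq_iff_modEq_mul hcop).1 ⟨?_, ?_⟩)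
      · exact (hu1.add hv1).symm
      · exact (hu2.add hv2).symm
    have hz1 : (z ^ u) ^ Nat.card G = 1 := by
      rw [← pow_mul, hpow hz (b := 0), pow_zero]
      simpa [mul_comm] using hu2.mul_left' (Nat.card G)
    have hz2 : (z ^ v) ^ Nat.card H = 1 := by
      rw [← pow_mul, hpow hz (b := 0), pow_zero]
      simpa using hv1.mul_right' (Nat.card H)
    have hsum : ∑ i, z ^ K i = (∑ i, (z ^ u) ^ k i) * ∑ i, (z ^ v) ^ k' i := by
      rw [Fintype.sum_mul_sum, ← Fintype.sum_prod_type']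
      refine Finset.sum_congr rfl fun i _ ↦ ?_
      conv_lhs => rw [huv, mul_pow, hpow hz1 (hK1 i), hpow hz2 (hK2 i)]
    have h6 := (charRing (G × H)).mul_mem
      (charRing_le_of_surjective (MonoidHom.fst G H) Prod.fst_surjective (h5 _ hz1))
      (charRing_le_of_surjective (MonoidHom.snd G H) Prod.snd_surjective (h5' _ hz2))
    convert h6 using 1
    rw [hsum, Fintype.card_prod]
    push_cast
    rw [mul_inv]
    ring

theorem averageProperty_of_card_eq_prime_pow [Finite G] {p N : ℕ} [Fact p.Prime]
    (hcard : Nat.card G = p ^ N) : AverageProperty G := by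
  rcases subsingleton_or_nontrivial G with _ | _
  · exact averageProperty_of_subsingleton
  · exact averageProperty_of_isPGroup hcard

theorem averageProperty_pi (ι : Type) [Fintype ι] :
    ∀ (M : ι → Type) [∀ i, Group (M i)] [∀ i, Finite (M i)], (∀ i, AverageProperty (M i)) →
      (Pairwise fun i j ↦ (Nat.card (M i)).Coprime (Nat.card (M j))) →
        AverageProperty (∀ i, M i) := by
  refine Fintype.induction_empty_option (P := fun ι _ ↦ ∀ (M : ι → Type) [∀ i, Group (M i)]
    [∀ i, Finite (M i)], (∀ i, AverageProperty (M i)) →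
      (Pairwise fun i j ↦ (Nat.card (M i)).Coprime (Nat.card (M j))) →
        AverageProperty (∀ i, M i)) ?_ ?_ ?_ ι
  · intro α β _ e ih M _ _ hM hcop
    have := Fintype.ofEquiv β e.symm
    exact (ih (fun a ↦ M (e a)) (fun a ↦ hM (e a)) fun a b hab ↦ hcop (e.injective.ne hab)).congr
      { Equiv.piCongrLeft M e with
        map_mul' := fun x y ↦ funext fun b ↦ by
          obtain ⟨a, rfl⟩ := e.surjective b
          simp }
  · intro M _ _ _ _
    exact averageProperty_of_subsingleton
  · intro α _ ih M _ _ hM hcop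
    have h1 := ih (fun a ↦ M (some a)) (fun a ↦ hM (some a))
      fun a b hab ↦ hcop ((Option.some_injective α).ne hab)
    have h2 := (hM none).prod h1 (by
      rw [Nat.card_pi]
      exact Nat.Coprime.prod_right fun a _ ↦ hcop (Option.some_ne_none a).symm)
    exact h2.congr ({ Equiv.piOptionEquivProd (β := M) with
      map_mul' := fun _ _ ↦ rfl } : (∀ i, M i) ≃* _).symm

theorem averageProperty_of_isNilpotent [Finite G] (hG : Group.IsNilpotent G) :
    AverageProperty G := by
  classical
  obtain ⟨e⟩ := (Group.isNilpotent_of_finite_tfae (G := G).out 0 4).1 hG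
  have hp (p : (Nat.card G).primeFactors) : Fact (p : ℕ).Prime :=
    ⟨Nat.prime_of_mem_primeFactors p.2⟩
  have hcard (p : (Nat.card G).primeFactors) :
      ∃ N, Nat.card (∀ P : Sylow p G, (↑P : Subgroup G)) = (p : ℕ) ^ N := by
    have := Fintype.ofFinite (Sylow p G)
    choose n hn using fun P : Sylow p G ↦ IsPGroup.iff_card.1 P.2
    refine ⟨∑ P, n P, ?_⟩
    rw [Nat.card_pi, ← Finset.prod_pow_eq_pow_sum]
    exact Finset.prod_congr rfl fun P _ ↦ hn P
  refine (averageProperty_pi _ _ (fun p ↦ ?_) fun p q hpq ↦ ?_).congr e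
  · obtain ⟨N, hN⟩ := hcard p
    exact averageProperty_of_card_eq_prime_pow hN
  · obtain ⟨N, hN⟩ := hcard p
    obtain ⟨N', hN'⟩ := hcard q
    rw [hN, hN']
    exact Nat.Coprime.pow _ _ ((Nat.coprime_primes (hp p).out (hp q).out).2
      (Subtype.coe_injective.ne hpq))

end Products

section CharacterField

theorem sum_fixedProj {R : Type} [Ring R] [Algebra ℂ R] {N : ℕ} (hN : N ≠ 0) {ζ : ℂ}
    (hζ : IsPrimitiveRoot ζ N) (A : R) :
    ∑ i ∈ Finset.range N, fixedProj N ((ζ ^ i)⁻¹ • A) = 1 := by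
  have h1 : ∀ j ∈ Finset.range N, ∑ i ∈ Finset.range N, ((ζ ^ i)⁻¹ • A) ^ j =
      if j = 0 then (N : ℂ) • (1 : R) else 0 := by
    intro j hj
    have h2 : ∀ i, ((ζ ^ i)⁻¹ • A) ^ j = ((ζ⁻¹ ^ j) ^ i) • A ^ j := fun i ↦ by
      rw [smul_pow, ← inv_pow, ← pow_mul, ← pow_mul, mul_comm]
    rw [Finset.sum_congr rfl fun i _ ↦ h2 i, ← Finset.sum_smul]
    split_ifs with h0
    · simp [h0]
    · have h3 : ζ⁻¹ ^ j ≠ 1 := hζ.inv.pow_ne_one_of_pos_of_lt h0 (Finset.mem_range.1 hj)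
      rw [geom_sum_eq h3, ← pow_mul, mul_comm, pow_mul, hζ.inv.pow_eq_one]
      simp
  simp only [fixedProj]
  rw [← Finset.smul_sum, Finset.sum_comm, Finset.sum_congr rfl h1, Finset.sum_ite_eq',
    if_pos (Finset.mem_range.2 (Nat.pos_of_ne_zero hN)), smul_smul,
    inv_mul_cancel₀ (by exact_mod_cast hN), one_smul]

theorem exists_trace_pow_eq_sum {V : Type} [AddCommGroup V] [Module ℂ V] [FiniteDimensional ℂ V]
    {N : ℕ} (hN : N ≠ 0) {ζ : ℂ} (hζ : IsPrimitiveRoot ζ N) {A : Module.End ℂ V}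
    (hA : A ^ N = 1) :
    ∃ m : ℕ → ℕ, ∀ k : ℕ,
      LinearMap.trace ℂ V (A ^ k) = ∑ i ∈ Finset.range N, (m i : ℂ) * (ζ ^ i) ^ k := by
  have hpow (i : ℕ) : ((ζ ^ i)⁻¹ • A) ^ N = 1 := by
    rw [smul_pow, hA, ← inv_pow, ← pow_mul, mul_comm, pow_mul, hζ.inv.pow_eq_one, one_pow, one_smul]
  have hmul (i : ℕ) : A * fixedProj N ((ζ ^ i)⁻¹ • A) = ζ ^ i • fixedProj N ((ζ ^ i)⁻¹ • A) := by
    conv_rhs => rw [← mul_fixedProj (hpow i), smul_mul_assoc,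
      smul_inv_smul₀ (pow_ne_zero _ (hζ.ne_zero hN))]
  have hmul' (i k : ℕ) : A ^ k * fixedProj N ((ζ ^ i)⁻¹ • A) =
      (ζ ^ i) ^ k • fixedProj N ((ζ ^ i)⁻¹ • A) := by
    induction k with
    | zero => simp
    | succ k ih => rw [pow_succ, mul_assoc, hmul, mul_smul_comm, ih, smul_smul, pow_succ']
  refine ⟨fun i ↦ finrank ℂ (LinearMap.range (fixedProj N ((ζ ^ i)⁻¹ • A))), fun k ↦ ?_⟩
  have h1 : A ^ k = ∑ i ∈ Finset.range N, (ζ ^ i) ^ k • fixedProj N ((ζ ^ i)⁻¹ • A) := by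
    rw [← mul_one (A ^ k), ← sum_fixedProj hN hζ A, Finset.mul_sum]
    exact Finset.sum_congr rfl fun i _ ↦ hmul' i k
  rw [h1, map_sum]
  refine Finset.sum_congr rfl fun i _ ↦ ?_
  have h2 : IsIdempotentElem (fixedProj N ((ζ ^ i)⁻¹ • A)) := fixedProj_mul_self hN (hpow i)
  rw [map_smul, smul_eq_mul, mul_comm, ((LinearMap.isProj_range_iff_isIdempotentElem _).2 h2).trace]

variable {G : Type} [Group G]

theorem exists_character_pow_eq_sum [Finite G] {ζ : ℂ} (hζ : IsPrimitiveRoot ζ (Nat.card G))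
    (V : FDRep ℂ G) (g : G) :
    ∃ m : ℕ → ℕ, ∀ k : ℕ,
      V.character (g ^ k) = ∑ i ∈ Finset.range (Nat.card G), (m i : ℂ) * (ζ ^ i) ^ k := by
  obtain ⟨m, hm⟩ := exists_trace_pow_eq_sum Nat.card_pos.ne' hζ (A := V.ρ g)
    (by rw [← map_pow, pow_card_eq_one', map_one])
  refine ⟨m, fun k ↦ ?_⟩
  rw [← hm, ← map_pow]
  rfl

theorem character_eq_of_isConj (V : FDRep ℂ G) {g h : G} (hgh : IsConj g h) :
    V.character g = V.character h := by
  obtain ⟨c, rfl⟩ := isConj_iff.1 hgh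
  exact (V.char_conj g c).symm

open IntermediateField in
theorem exists_algHom_cyclotomic {N : ℕ} [NeZero N] {ζ : ℂ} (hζ : IsPrimitiveRoot ζ N) {k : ℕ}
    (hk : k.Coprime N) : ∃ σ : ℚ⟮ζ⟯ →ₐ[ℚ] ℂ, σ (AdjoinSimple.gen ℚ ζ) = ζ ^ k := by
  have hζint : IsIntegral ℚ ζ := (hζ.isIntegral (NeZero.pos N)).tower_top
  refine ⟨(algHomAdjoinIntegralEquiv ℚ hζint).symm ⟨ζ ^ k, ?_⟩,
    algHomAdjoinIntegralEquiv_symm_apply_gen ℚ hζint _⟩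
  rw [Polynomial.mem_aroots, ← Polynomial.cyclotomic_eq_minpoly_rat hζ (NeZero.pos N),
    Polynomial.cyclotomic_eq_minpoly_rat (hζ.pow_of_coprime k hk) (NeZero.pos N)]
  exact ⟨minpoly.ne_zero (hζint.pow k), minpoly.aeval _ _⟩

open IntermediateField in
theorem charField_le_of_isConj_pow [Finite G] {ζ : ℂ} (hζ : IsPrimitiveRoot ζ (Nat.card G))
    {k : ℕ} {σ : ℚ⟮ζ⟯ →ₐ[ℚ] ℂ} (hσ : σ (AdjoinSimple.gen ℚ ζ) = ζ ^ k)
    (hconj : ∀ g : G, IsConj g (g ^ k)) :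
    charField G ≤ (RingHom.eqLocusField (σ : ℚ⟮ζ⟯ →+* ℂ) (ℚ⟮ζ⟯.val : ℚ⟮ζ⟯ →+* ℂ)).map
      (ℚ⟮ζ⟯.val : ℚ⟮ζ⟯ →+* ℂ) := by
  refine Subfield.closure_le.2 ?_
  rintro _ ⟨V, -, g, rfl⟩
  obtain ⟨m, hm⟩ := exists_character_pow_eq_sum hζ V g
  have h1 := hm 1
  rw [pow_one] at h1
  have hval : ℚ⟮ζ⟯.val (AdjoinSimple.gen ℚ ζ) = ζ := AdjoinSimple.coe_gen ℚ ζ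
  let y : ℚ⟮ζ⟯ := ∑ i ∈ Finset.range (Nat.card G), (m i : ℚ⟮ζ⟯) * AdjoinSimple.gen ℚ ζ ^ i
  have hy : ℚ⟮ζ⟯.val y = V.character g := by
    simp only [y, map_sum, map_mul, map_natCast, map_pow, hval, h1, pow_one]
  refine ⟨y, ?_, hy⟩
  change σ y = ℚ⟮ζ⟯.val y
  rw [hy, character_eq_of_isConj V (hconj g), hm k]
  simp only [y, map_sum, map_mul, map_natCast, map_pow, hσ]
  exact Finset.sum_congr rfl fun i _ ↦ by rw [← pow_mul, ← pow_mul, mul_comm k]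

open IntermediateField in
theorem exists_eq_aeval_pow [Finite G] {ζ : ℂ} (hζ : IsPrimitiveRoot ζ (Nat.card G)) {x : ℂ}
    (hx : x ∈ ringOfIntIn (charField G)) :
    ∃ P : Polynomial ℤ, ∀ k : ℕ, k.Coprime (Nat.card G) → (∀ g : G, IsConj g (g ^ k)) →
      x = Polynomial.aeval (ζ ^ k) P := by
  have : NeZero (Nat.card G) := ⟨Nat.card_pos.ne'⟩
  have hQ : IsIntegral ℚ ζ := (hζ.isIntegral (NeZero.pos (Nat.card G))).tower_top
  have hcyc : IsCyclotomicExtension {Nat.card G} ℚ ℚ⟮ζ⟯ := by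
    change IsCyclotomicExtension {Nat.card G} ℚ ℚ⟮ζ⟯.toSubalgebra
    rw [adjoin_simple_toSubalgebra_of_isAlgebraic hQ.isAlgebraic]
    exact hζ.adjoin_isCyclotomicExtension ℚ
  have hval : ℚ⟮ζ⟯.val (AdjoinSimple.gen ℚ ζ) = ζ := AdjoinSimple.coe_gen ℚ ζ
  have hgen : IsPrimitiveRoot (AdjoinSimple.gen ℚ ζ) (Nat.card G) :=
    IsPrimitiveRoot.of_map_of_injective (f := ℚ⟮ζ⟯.val) (by rwa [hval]) ℚ⟮ζ⟯.val.injective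
  obtain ⟨hxint, hfield⟩ := hx
  have hx1 : x ∈ ℚ⟮ζ⟯ := by
    obtain ⟨σ, hσ⟩ := exists_algHom_cyclotomic hζ (Nat.coprime_one_left _)
    obtain ⟨y, -, rfl⟩ := charField_le_of_isConj_pow hζ hσ
      (fun g ↦ by rw [pow_one]) hfield
    exact y.2
  have hxint' : IsIntegral ℤ (⟨x, hx1⟩ : ℚ⟮ζ⟯) := by
    refine (isIntegral_algHom_iff (ℚ⟮ζ⟯.val.restrictScalars ℤ) ℚ⟮ζ⟯.val.injective).1 ?_
    exact hxint
  obtain ⟨⟨z, hz⟩, hzx⟩ :=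
    (IsCyclotomicExtension.Rat.isIntegralClosure_adjoin_singleton hgen).isIntegral_iff.1 hxint'
  rw [Algebra.adjoin_singleton_eq_range_aeval] at hz
  obtain ⟨P, rfl⟩ := hz
  have hP : Polynomial.aeval (AdjoinSimple.gen ℚ ζ) P = (⟨x, hx1⟩ : ℚ⟮ζ⟯) := hzx
  refine ⟨P, fun k hk hconj ↦ ?_⟩
  obtain ⟨σ, hσ⟩ := exists_algHom_cyclotomic hζ hk
  obtain ⟨y, hy, hyx⟩ := charField_le_of_isConj_pow hζ hσ hconj hfield
  have hyx' : y = ⟨x, hx1⟩ := Subtype.ext hyx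
  have h1 : σ y = x := (show σ y = ℚ⟮ζ⟯.val y from hy).trans hyx
  rw [← h1, ← hσ, hyx', ← hP]
  exact (Polynomial.aeval_algHom_apply (σ.restrictScalars ℤ) _ P).symm

theorem AverageProperty.exists_mul_mem_charRing [Finite G] (h : AverageProperty G) :
    ∃ E : ℕ, E ∣ Nat.card G ∧ (Nontrivial G → E ≠ Nat.card G) ∧
      ∀ x ∈ ringOfIntIn (charField G), (E : ℂ) * x ∈ charRing G := by
  obtain ⟨E, ι, _, _, k, hk, hconj, hdvd, hne, hE⟩ := h
  refine ⟨E, hdvd, hne, fun x hx ↦ ?_⟩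
  have hζ := Complex.isPrimitiveRoot_exp (Nat.card G) Nat.card_pos.ne'
  generalize Complex.exp (2 * Real.pi * Complex.I / (Nat.card G)) = ζ at hζ
  obtain ⟨P, hP⟩ := exists_eq_aeval_pow hζ hx
  have hcard : (Fintype.card ι : ℂ) ≠ 0 := by exact_mod_cast Fintype.card_ne_zero
  have h1 : (Fintype.card ι : ℂ) * x =
      ∑ j ∈ Finset.range (P.natDegree + 1), (P.coeff j : ℂ) * ∑ i, (ζ ^ j) ^ k i := by
    calc (Fintype.card ι : ℂ) * x = ∑ i : ι, Polynomial.aeval (ζ ^ k i) P := by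
          rw [Finset.sum_congr rfl fun i _ ↦ (hP (k i) (hk i) (hconj i)).symm]
          simp
      _ = _ := by
          simp only [Polynomial.aeval_eq_sum_range, zsmul_eq_mul, Finset.mul_sum]
          rw [Finset.sum_comm]
          refine Finset.sum_congr rfl fun j _ ↦ Finset.sum_congr rfl fun i _ ↦ ?_
          rw [← pow_mul, ← pow_mul, mul_comm j]
  have h2 : (E : ℂ) * x = ∑ j ∈ Finset.range (P.natDegree + 1),
      (P.coeff j : ℂ) * (E * ((Fintype.card ι : ℂ)⁻¹ * ∑ i, (ζ ^ j) ^ k i)) := by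
    calc (E : ℂ) * x = E * ((Fintype.card ι : ℂ)⁻¹ * ((Fintype.card ι : ℂ) * x)) := by
          rw [inv_mul_cancel_left₀ hcard]
      _ = _ := by
          rw [h1, Finset.mul_sum, Finset.mul_sum]
          exact Finset.sum_congr rfl fun j _ ↦ by ring
  rw [h2]
  refine Subring.sum_mem _ fun j _ ↦ Subring.mul_mem _ (intCast_mem _ _) (hE _ ?_)
  rw [← pow_mul, mul_comm, pow_mul, hζ.pow_eq_one, one_pow]

theorem exponent_charQuot_dvd {E : ℕ}
    (h : ∀ x ∈ ringOfIntIn (charField G), (E : ℂ) * x ∈ charRing G) :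
    AddMonoid.exponent (charQuot G) ∣ E := by
  refine AddMonoid.exponent_dvd_of_forall_nsmul_eq_zero fun x ↦ ?_
  induction x using QuotientAddGroup.induction_on with
  | H x =>
    refine (QuotientAddGroup.eq_zero_iff (E • x)).2 ?_
    change ((E • x : _) : ℂ) ∈ charRing G
    simpa [nsmul_eq_mul] using h x x.2

end CharacterField

/-- For a nontrivial finite nilpotent group `G`, the exponent of
`ℤ_{ℚ(G)}/ℤ[G]` is a proper divisor of `|G|`; in particular `|G|·ℤ_{ℚ(G)} ⊆ ℤ[G]`. -/
theorem exponent_charQuot_properly_dvd_card_of_nilpotent (G : Type) [Group G] [Finite G]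
    [Nontrivial G] (hnil : Group.IsNilpotent G) :
    AddMonoid.exponent (charQuot G) ∣ Nat.card G ∧
    AddMonoid.exponent (charQuot G) ≠ Nat.card G ∧
    ∀ x ∈ ringOfIntIn (charField G), (Nat.card G : ℂ) * x ∈ charRing G := by
  obtain ⟨E, hdvd, hne, hE⟩ := (averageProperty_of_isNilpotent hnil).exists_mul_mem_charRing
  have h1 := exponent_charQuot_dvd hE
  refine ⟨h1.trans hdvd, fun h ↦ hne inferInstance (Nat.dvd_antisymm hdvd (h ▸ h1)), fun x hx ↦ ?_⟩
  obtain ⟨c, hc⟩ := hdvd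
  rw [hc, Nat.cast_mul, mul_comm (E : ℂ), mul_assoc]
  exact Subring.mul_mem _ (natCast_mem _ _) (hE x hx)
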